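/- Assume p ≠ 2, let l ∈ F_q^× be a non-square, let B_3 = uv + a_3 v^2 + b_3 vw + c_3 w^2 with X^3 + a_3 X^2 + b_3 X + c_3 irreducible over F_q, and let B_4 = u^2 + a_4 uv + b_4 v^2 + c_4 vw + d_4 w^2 with X^4 + a_4 X^3 + b_4 X^2 + c_4 X + d_4 irreducible over F_q. The action of G = GL_2(F_q) × GL_3(F_q) on the space V of pairs of ternary quadratic forms has exactly twenty orbits, with representatives (0,0), (0,w^2), (0,vw), (0,v^2−lw^2), (0,u^2−vw), (w^2,vw), (vw,uw), (w^2,v^2), (vw,v^2+lw^2), (w^2,uw+v^2), (vw,uw+v^2), (w^2,u^2−v^2), (w^2,u^2−lv^2), (v^2−w^2,uw), (v^2−lw^2,uw), (uw−vw,uv−vw), (vw,u^2−v^2−lw^2), (vw,u^2−lv^2−lw^2), (uw−v^2,B_3), (uw−v^2,B_4). Writing s(a,b,c,d) = (q−1)^a q^b (q+1)^c (q^2+q+1)^{d/2}, the sizes of these orbits are respectively 1, s(1,0,1,2), s(1,1,2,2)/2, s(2,1,1,2)/2, s(2,2,1,2), s(2,1,2,2), s(2,3,1,2), s(2,2,2,2)/2,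 s(3,2,1,2)/2, s(3,2,2,2), s(3,3,2,2), s(2,4,2,2)/2, s(3,4,1,2)/2, s(3,4,2,2)/2, s(3,4,2,2)/2, s(4,4,2,2)/24, s(4,4,2,2)/4, s(4,4,2,2)/8, s(4,4,2,2)/3, s(4,4,2,2)/4, and the number of common zeros in P^2(F_q) of any element of these orbits is respectively q^2+q+1, q+1, 2q+1, 1, q+1, q+1, q+2, 1, 1, 1, 2, 2, 0, 3, 1, 4, 2, 0, 1, 0. -/

import Mathlib

open scoped Classical
open MvPolynomial Matrix

noncomputable section

/-- The standard additive character `t ↦ exp(2πi·Tr_{F/F_p}(t)/p)` of a finite field `F`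
of characteristic `p`. -/
def psiF (p : ℕ) [Fact p.Prime] (F : Type*) [Field F] [Fintype F] [CharP F p] (t : F) : ℂ :=
  letI : Algebra (ZMod p) F := ZMod.algebra F p
  Complex.exp (2 * Real.pi * Complex.I * ((Algebra.trace (ZMod p) F t).val : ℂ) / (p : ℂ))

variable {F : Type*} [Field F] [Fintype F]

/-- The ternary quadratic form `a u² + b uv + c uw + d v² + e vw + f w²`
attached to `(a,b,c,d,e,f)`. -/
def TQ (c : Fin 6 → F) : MvPolynomial (Fin 3) F :=
  C (c 0) * X 0 ^ 2 + C (c 1) * X 0 * X 1 + C (c 2) * X 0 * X 2 +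
    C (c 3) * X 1 ^ 2 + C (c 4) * X 1 * X 2 + C (c 5) * X 2 ^ 2

/-- Substitution corresponding to the linear change of variables `(u,v,w) ↦ (u,v,w)·g`. -/
def subst3 (g : Matrix (Fin 3) (Fin 3) F) (P : MvPolynomial (Fin 3) F) : MvPolynomial (Fin 3) F :=
  aeval (fun j => ∑ i : Fin 3, C (g i j) * X i) P

/-- The action of `GL₂(F) × GL₃(F)` on pairs of ternary quadratic forms:
`(g₁,g₂)∘(A,B) = (α g₂Ag₂ᵀ + β g₂Bg₂ᵀ, γ g₂Ag₂ᵀ + δ g₂Bg₂ᵀ)` for `g₁ = [[α,β],[γ,δ]]`,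
written at the level of the associated quadratic forms. -/
def pairActT (g₁ : Matrix.GeneralLinearGroup (Fin 2) F)
    (g₂ : Matrix.GeneralLinearGroup (Fin 3) F)
    (PQ : MvPolynomial (Fin 3) F × MvPolynomial (Fin 3) F) :
    MvPolynomial (Fin 3) F × MvPolynomial (Fin 3) F :=
  (C ((g₁ : Matrix (Fin 2) (Fin 2) F) 0 0) * subst3 (g₂ : Matrix (Fin 3) (Fin 3) F) PQ.1 +
     C ((g₁ : Matrix (Fin 2) (Fin 2) F) 0 1) * subst3 (g₂ : Matrix (Fin 3) (Fin 3) F) PQ.2,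
   C ((g₁ : Matrix (Fin 2) (Fin 2) F) 1 0) * subst3 (g₂ : Matrix (Fin 3) (Fin 3) F) PQ.1 +
     C ((g₁ : Matrix (Fin 2) (Fin 2) F) 1 1) * subst3 (g₂ : Matrix (Fin 3) (Fin 3) F) PQ.2)

/-- `x` lies in the `GL₂(F) × GL₃(F)`-orbit of `r` (pairs of ternary quadratic forms). -/
def InOrbitPT (r x : (Fin 6 → F) × (Fin 6 → F)) : Prop :=
  ∃ (g₁ : Matrix.GeneralLinearGroup (Fin 2) F) (g₂ : Matrix.GeneralLinearGroup (Fin 3) F),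
    pairActT g₁ g₂ (TQ r.1, TQ r.2) = (TQ x.1, TQ x.2)

/-- The symmetric 3×3 matrix attached to the ternary quadratic form `(a,b,c,d,e,f)`. -/
def gram3 (x : Fin 6 → F) : Matrix (Fin 3) (Fin 3) F :=
  !![x 0, x 1 / 2, x 2 / 2; x 1 / 2, x 3, x 4 / 2; x 2 / 2, x 4 / 2, x 5]

/-- The cubic resolvent `r_x(u,v) = -4 det(Au + Bv)` of a pair `x = (A,B)` of ternary
quadratic forms, a binary cubic form in the variables `u = X 0`, `v = X 1`. -/
def resolventPT (x : (Fin 6 → F) × (Fin 6 → F)) : MvPolynomial (Fin 2) F :=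
  (-4 : MvPolynomial (Fin 2) F) *
    (Matrix.of fun i j => C (gram3 x.1 i j) * X 0 + C (gram3 x.2 i j) * X 1).det

/-- Discriminant of the binary cubic form `a u³ + b u²v + c uv² + d v³`. -/
def discCubic (a b c d : F) : F :=
  b^2*c^2 + 18*a*b*c*d - 4*a*c^3 - 4*b^3*d - 27*a^2*d^2

/-- `Disc(x) = disc(r_x)` for a pair of ternary quadratic forms. -/
def DiscPT (x : (Fin 6 → F) × (Fin 6 → F)) : F :=
  discCubic
    (coeff (Finsupp.single 0 3) (resolventPT x))
    (coeff (Finsupp.single 0 2 + Finsupp.single 1 1) (resolventPT x))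
    (coeff (Finsupp.single 0 1 + Finsupp.single 1 2) (resolventPT x))
    (coeff (Finsupp.single 1 3) (resolventPT x))

/-- The number of common zeros in `ℙ²(F)` of a pair of ternary quadratic forms. -/
def commonZerosPT (x : (Fin 6 → F) × (Fin 6 → F)) : ℕ :=
  Nat.card {P : Projectivization F (Fin 3 → F) //
    MvPolynomial.eval P.rep (TQ x.1) = 0 ∧ MvPolynomial.eval P.rep (TQ x.2) = 0}

set_option linter.unusedSectionVars false

section Forms

variable {R : Type*} [CommRing R]

/-- The value at `x` of the ternary quadratic form with coefficients `c`. -/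
def formEval (c : Fin 6 → R) (x : Fin 3 → R) : R :=
  c 0 * x 0 ^ 2 + c 1 * x 0 * x 1 + c 2 * x 0 * x 2 + c 3 * x 1 ^ 2 + c 4 * x 1 * x 2 +
    c 5 * x 2 ^ 2

/-- The polarization of the ternary quadratic form with coefficients `c`. -/
def formPolar (c : Fin 6 → R) (x y : Fin 3 → R) : R :=
  2 * c 0 * x 0 * y 0 + c 1 * (x 0 * y 1 + x 1 * y 0) + c 2 * (x 0 * y 2 + x 2 * y 0) +
    2 * c 3 * x 1 * y 1 + c 4 * (x 1 * y 2 + x 2 * y 1) + 2 * c 5 * x 2 * y 2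

/-- The coefficients of the product of two ternary linear forms. -/
def linProd (l m : Fin 3 → R) : Fin 6 → R :=
  ![l 0 * m 0, l 0 * m 1 + l 1 * m 0, l 0 * m 2 + l 2 * m 0, l 1 * m 1, l 1 * m 2 + l 2 * m 1,
    l 2 * m 2]

/-- The coefficients of the form with coefficients `c` after the substitution
`(u,v,w) ↦ (u,v,w)·g`. -/
def formSubst (g : Matrix (Fin 3) (Fin 3) R) (c : Fin 6 → R) : Fin 6 → R :=
  ![formEval c (g 0), formPolar c (g 0) (g 1), formPolar c (g 0) (g 2), formEval c (g 1),
    formPolar c (g 1) (g 2), formEval c (g 2)]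

lemma formEval_formSubst (g : Matrix (Fin 3) (Fin 3) R) (c : Fin 6 → R) (x : Fin 3 → R) :
    formEval (formSubst g c) x = formEval c (x ᵥ* g) := by
  simp [formEval, formSubst, formPolar, Matrix.vecMul, dotProduct, Fin.sum_univ_three]
  ring

lemma formPolar_formSubst (g : Matrix (Fin 3) (Fin 3) R) (c : Fin 6 → R) (x y : Fin 3 → R) :
    formPolar (formSubst g c) x y = formPolar c (x ᵥ* g) (y ᵥ* g) := by
  simp [formEval, formSubst, formPolar, Matrix.vecMul, dotProduct, Fin.sum_univ_three]
  ring

lemma formSubst_linProd (g : Matrix (Fin 3) (Fin 3) R) (l m : Fin 3 → R) :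
    formSubst g (linProd l m) = linProd (g *ᵥ l) (g *ᵥ m) := by
  funext i
  fin_cases i <;>
    simp [formEval, formSubst, formPolar, linProd, Matrix.mulVec, dotProduct,
      Fin.sum_univ_three] <;> ring

lemma formSubst_mul (g h : Matrix (Fin 3) (Fin 3) R) (c : Fin 6 → R) :
    formSubst (g * h) c = formSubst g (formSubst h c) := by
  have row (i : Fin 3) : (g * h) i = g i ᵥ* h := rfl
  rw [formSubst, row, row, row]
  conv_rhs => rw [formSubst]
  simp only [formEval_formSubst, formPolar_formSubst]

lemma formSubst_one (c : Fin 6 → R) : formSubst 1 c = c := by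
  funext i
  fin_cases i <;> simp [formEval, formSubst, formPolar]

lemma formEval_add (c d : Fin 6 → R) (x : Fin 3 → R) :
    formEval (c + d) x = formEval c x + formEval d x := by
  simp [formEval]; ring

lemma formEval_smul (a : R) (c : Fin 6 → R) (x : Fin 3 → R) :
    formEval (a • c) x = a * formEval c x := by
  simp [formEval]; ring

lemma formEval_vec_smul (a : R) (c : Fin 6 → R) (x : Fin 3 → R) :
    formEval c (a • x) = a ^ 2 * formEval c x := by
  simp [formEval]; ring

lemma formPolar_add (c d : Fin 6 → R) (x y : Fin 3 → R) :
    formPolar (c + d) x y = formPolar c x y + formPolar d x y := by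
  simp [formPolar]; ring

lemma formPolar_smul (a : R) (c : Fin 6 → R) (x y : Fin 3 → R) :
    formPolar (a • c) x y = a * formPolar c x y := by
  simp [formPolar]; ring

lemma formSubst_add (g : Matrix (Fin 3) (Fin 3) R) (c d : Fin 6 → R) :
    formSubst g (c + d) = formSubst g c + formSubst g d := by
  simp [formSubst, formEval_add, formPolar_add]

lemma formSubst_smul (g : Matrix (Fin 3) (Fin 3) R) (a : R) (c : Fin 6 → R) :
    formSubst g (a • c) = a • formSubst g c := by
  simp [formSubst, formEval_smul, formPolar_smul]

end Forms

lemma TQ_add (c d : Fin 6 → F) : TQ (c + d) = TQ c + TQ d := by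
  simp only [TQ, Pi.add_apply, C_add]; ring

lemma C_mul_TQ (a : F) (c : Fin 6 → F) : C a * TQ c = TQ (a • c) := by
  simp only [TQ, Pi.smul_apply, smul_eq_mul, C_mul]; ring

lemma eval_TQ (c : Fin 6 → F) (x : Fin 3 → F) : MvPolynomial.eval x (TQ c) = formEval c x := by
  simp [TQ, formEval]

lemma subst3_TQ (g : Matrix (Fin 3) (Fin 3) F) (c : Fin 6 → F) :
    subst3 g (TQ c) = TQ (formSubst g c) := by
  simp [subst3, TQ, formSubst, formEval, formPolar, Fin.sum_univ_three]
  rw [show (C (2 : F) : MvPolynomial (Fin 3) F) = 2 from map_ofNat C 2]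
  ring

lemma TQ_injective : Function.Injective (TQ : (Fin 6 → F) → MvPolynomial (Fin 3) F) := by
  intro c d h
  have key (x : Fin 3 → Polynomial F) : formEval (fun i => Polynomial.C (c i)) x =
      formEval (fun i => Polynomial.C (d i)) x := by
    have := congrArg (aeval x) h
    simpa [TQ, formEval, ← Polynomial.C_eq_algebraMap] using this
  have h0 := congrArg (Polynomial.eval 1) (key ![1, 0, 0])
  have h3 := congrArg (Polynomial.eval 1) (key ![0, 1, 0])
  have h5 := congrArg (Polynomial.eval 1) (key ![0, 0, 1])
  have h1 := congrArg (Polynomial.eval 1) (key ![1, 1, 0])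
  have h2 := congrArg (Polynomial.eval 1) (key ![1, 0, 1])
  have h4 := congrArg (Polynomial.eval 1) (key ![0, 1, 1])
  simp [formEval] at h0 h1 h2 h3 h4 h5
  simp only [h0, h3, h5, add_left_inj, add_right_inj] at h1 h2 h4
  funext i
  fin_cases i <;> assumption

/-- Pairs of ternary quadratic forms, as a type carrying the action of `GL₂(F) × GL₃(F)`. -/
@[ext]
structure FormPair (F : Type*) where
  /-- the first form -/
  fst : Fin 6 → F
  /-- the second form -/
  snd : Fin 6 → F

/-- Pairs of forms as elements of a product. -/
def FormPair.equivProd (F : Type*) : FormPair F ≃ (Fin 6 → F) × (Fin 6 → F) where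
  toFun x := (x.fst, x.snd)
  invFun x := ⟨x.1, x.2⟩

instance : SMul (GL (Fin 2) F × GL (Fin 3) F) (FormPair F) where
  smul g x := ⟨g.1 0 0 • formSubst g.2 x.fst + g.1 0 1 • formSubst g.2 x.snd,
    g.1 1 0 • formSubst g.2 x.fst + g.1 1 1 • formSubst g.2 x.snd⟩

lemma FormPair.smul_fst (g : GL (Fin 2) F × GL (Fin 3) F) (x : FormPair F) :
    (g • x).fst = g.1 0 0 • formSubst g.2 x.fst + g.1 0 1 • formSubst g.2 x.snd := rfl

lemma FormPair.smul_snd (g : GL (Fin 2) F × GL (Fin 3) F) (x : FormPair F) :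
    (g • x).snd = g.1 1 0 • formSubst g.2 x.fst + g.1 1 1 • formSubst g.2 x.snd := rfl

instance : MulAction (GL (Fin 2) F × GL (Fin 3) F) (FormPair F) where
  one_smul x := by
    refine FormPair.ext ?_ ?_ <;> simp [FormPair.smul_fst, FormPair.smul_snd, formSubst_one]
  mul_smul g h x := by
    refine FormPair.ext ?_ ?_ <;>
    · simp only [FormPair.smul_fst, FormPair.smul_snd, formSubst_add, formSubst_smul,
        ← formSubst_mul, Prod.fst_mul, Prod.snd_mul, Units.val_mul, Matrix.mul_apply,
        Fin.sum_univ_two]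
      module

lemma inOrbitPT_iff (r x : (Fin 6 → F) × (Fin 6 → F)) :
    InOrbitPT r x ↔ (⟨x.1, x.2⟩ : FormPair F) ∈
      MulAction.orbit (GL (Fin 2) F × GL (Fin 3) F) (⟨r.1, r.2⟩ : FormPair F) := by
  simp only [InOrbitPT, pairActT, subst3_TQ, C_mul_TQ, ← TQ_add, Prod.mk.injEq,
    TQ_injective.eq_iff, MulAction.mem_orbit_iff, Prod.exists, FormPair.ext_iff,
    FormPair.smul_fst, FormPair.smul_snd]

instance : Finite (FormPair F) := Finite.of_equiv _ (FormPair.equivProd F).symm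

/-- The invertible substitutions which preserve the span of `A` and `B`. -/
def pencilStabilizer (A B : Fin 6 → F) : Finset (Matrix (Fin 3) (Fin 3) F) :=
  {h | h.det ≠ 0 ∧ (∃ a b : F, formSubst h A = a • A + b • B) ∧
    ∃ a b : F, formSubst h B = a • A + b • B}

/-- The invertible substitutions which preserve the line spanned by `B`. -/
def lineStabilizer (B : Fin 6 → F) : Finset (Matrix (Fin 3) (Fin 3) F) :=
  {h | h.det ≠ 0 ∧ ∃ a : F, formSubst h B = a • B}

lemma FormPair.inv_smul_eq {x : FormPair F} {g : GL (Fin 2) F × GL (Fin 3) F}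
    (hg : g ∈ MulAction.stabilizer (GL (Fin 2) F × GL (Fin 3) F) x) :
    ((1, g.2) : GL (Fin 2) F × GL (Fin 3) F) • x =
      ((g.1⁻¹, 1) : GL (Fin 2) F × GL (Fin 3) F) • x := by
  conv_rhs => rw [← MulAction.mem_stabilizer_iff.mp hg]
  rw [← mul_smul, show ((g.1⁻¹, 1) : GL (Fin 2) F × GL (Fin 3) F) * g = (1, g.2) by
    ext1 <;> simp]

lemma FormPair.formSubst_of_mem_stabilizer {A B : Fin 6 → F}
    {g : GL (Fin 2) F × GL (Fin 3) F}
    (hg : g ∈ MulAction.stabilizer (GL (Fin 2) F × GL (Fin 3) F) (⟨A, B⟩ : FormPair F)) :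
    formSubst g.2 A = g.1⁻¹ 0 0 • A + g.1⁻¹ 0 1 • B ∧
      formSubst g.2 B = g.1⁻¹ 1 0 • A + g.1⁻¹ 1 1 • B := by
  have h := FormPair.inv_smul_eq hg
  simp only [FormPair.ext_iff, FormPair.smul_fst, FormPair.smul_snd, Units.val_one,
    formSubst_one] at h
  simpa using h

lemma card_stabilizer_le_pencil {A B : Fin 6 → F}
    (hAB : ∀ a b : F, a • A + b • B = 0 → a = 0 ∧ b = 0) :
    Nat.card (MulAction.stabilizer (GL (Fin 2) F × GL (Fin 3) F) (⟨A, B⟩ : FormPair F)) ≤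
      (pencilStabilizer A B).card := by
  rw [← Nat.card_eq_finsetCard]
  have key := fun g : MulAction.stabilizer (GL (Fin 2) F × GL (Fin 3) F) (⟨A, B⟩ : FormPair F) =>
    FormPair.formSubst_of_mem_stabilizer g.2
  refine Nat.card_le_card_of_injective (fun g => ⟨(g.1.2 : Matrix (Fin 3) (Fin 3) F), ?_⟩) ?_
  · simp only [pencilStabilizer, Finset.mem_filter, Finset.mem_univ, true_and]
    exact ⟨g.1.2.det.ne_zero, ⟨_, _, (key g).1⟩, ⟨_, _, (key g).2⟩⟩
  · intro g g' h
    have h2 : (g.1.2 : Matrix (Fin 3) (Fin 3) F) = g'.1.2 := congrArg Subtype.val h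
    have k := key g
    have k' := key g'
    rw [h2] at k
    have h3 := hAB (g.1.1⁻¹ 0 0 - g'.1.1⁻¹ 0 0) (g.1.1⁻¹ 0 1 - g'.1.1⁻¹ 0 1) (by
      linear_combination (norm := module) k'.1 - k.1)
    have h4 := hAB (g.1.1⁻¹ 1 0 - g'.1.1⁻¹ 1 0) (g.1.1⁻¹ 1 1 - g'.1.1⁻¹ 1 1) (by
      linear_combination (norm := module) k'.2 - k.2)
    simp only [sub_eq_zero] at h3 h4
    refine Subtype.ext (Prod.ext (inv_injective (Units.ext ?_)) (Units.ext h2))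
    ext i j
    fin_cases i <;> fin_cases j
    exacts [h3.1, h3.2, h4.1, h4.2]

lemma card_erase_zero : ((Finset.univ : Finset F).erase 0).card = Fintype.card F - 1 := by
  simp [Finset.card_erase_of_mem]

lemma card_stabilizer_le_line {B : Fin 6 → F} (hB : B ≠ 0) :
    Nat.card (MulAction.stabilizer (GL (Fin 2) F × GL (Fin 3) F) (⟨0, B⟩ : FormPair F)) ≤
      (Fintype.card F - 1) * Fintype.card F * (lineStabilizer B).card := by
  rw [← card_erase_zero, ← Finset.card_univ, ← Finset.card_product, ← Finset.card_product,
    ← Nat.card_eq_finsetCard]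
  have key := fun g : MulAction.stabilizer (GL (Fin 2) F × GL (Fin 3) F) (⟨0, B⟩ : FormPair F) =>
    FormPair.formSubst_of_mem_stabilizer g.2
  have key1 (g : MulAction.stabilizer (GL (Fin 2) F × GL (Fin 3) F) (⟨0, B⟩ : FormPair F)) :
      g.1.1⁻¹ 0 1 = 0 := by
    have h1 : formSubst (g.1.2 : Matrix (Fin 3) (Fin 3) F) (0 : Fin 6 → F) = 0 := by
      simpa using formSubst_smul (g.1.2 : Matrix (Fin 3) (Fin 3) F) (0 : F) 0
    have := (key g).1
    rw [h1] at this
    simpa [hB] using this.symm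
  refine Nat.card_le_card_of_injective (fun g => ⟨((g.1.1⁻¹ 0 0, g.1.1⁻¹ 1 0),
    (g.1.2 : Matrix (Fin 3) (Fin 3) F)), ?_⟩) ?_
  · simp only [lineStabilizer, Finset.mem_product, Finset.mem_erase, Finset.mem_filter,
      Finset.mem_univ, true_and, and_true]
    refine ⟨fun h => (g.1.1⁻¹).det.ne_zero ?_, g.1.2.det.ne_zero, _, by simpa using (key g).2⟩
    have := key1 g
    simp only [GeneralLinearGroup.val_det_apply, Matrix.det_fin_two]
    rw [h, this]
    ring
  · intro g g' h
    have h := congrArg Subtype.val h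
    simp only [Prod.mk.injEq] at h
    have k := (key g).2
    have k' := (key g').2
    rw [h.2, k'] at k
    simp only [smul_zero, zero_add] at k
    refine Subtype.ext (Prod.ext (inv_injective (Units.ext ?_)) (Units.ext h.2))
    ext i j
    fin_cases i <;> fin_cases j
    exacts [h.1.1, (key1 g).trans (key1 g').symm, h.1.2, (smul_left_injective F hB k).symm]

lemma one_lt_card_field : 1 < Fintype.card F := Fintype.one_lt_card

lemma card_group : (Nat.card (GL (Fin 2) F × GL (Fin 3) F) : ℚ) =
    ((Fintype.card F : ℚ) - 1) ^ 5 * (Fintype.card F : ℚ) ^ 4 * ((Fintype.card F : ℚ) + 1) ^ 2 *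
      ((Fintype.card F : ℚ) ^ 2 + Fintype.card F + 1) := by
  have hq : 1 ≤ Fintype.card F := Fintype.card_pos
  have h1 : 1 ≤ Fintype.card F ^ 2 := Nat.one_le_pow _ _ hq
  have h2 : 1 ≤ Fintype.card F ^ 3 := Nat.one_le_pow _ _ hq
  have h3 : Fintype.card F ≤ Fintype.card F ^ 2 := Nat.le_self_pow (by norm_num) _
  have h4 : Fintype.card F ≤ Fintype.card F ^ 3 := Nat.le_self_pow (by norm_num) _
  have h5 : Fintype.card F ^ 2 ≤ Fintype.card F ^ 3 := Nat.pow_le_pow_right hq (by norm_num)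
  rw [Nat.card_prod, Matrix.card_GL_field, Matrix.card_GL_field]
  simp only [Fin.prod_univ_two, Fin.prod_univ_three, Fin.val_zero, Fin.val_one, Fin.val_two,
    pow_zero, pow_one]
  push_cast [h1, h2, h3, h4, h5]
  ring

/-- A bound on the order of a stabilizer bounds the size of the orbit from below. -/
lemma le_card_orbit_mul {x : FormPair F} {N : ℕ}
    (h : Nat.card (MulAction.stabilizer (GL (Fin 2) F × GL (Fin 3) F) x) ≤ N) :
    ((Fintype.card F : ℚ) - 1) ^ 5 * (Fintype.card F : ℚ) ^ 4 * ((Fintype.card F : ℚ) + 1) ^ 2 *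
      ((Fintype.card F : ℚ) ^ 2 + Fintype.card F + 1) ≤
    Nat.card (MulAction.orbit (GL (Fin 2) F × GL (Fin 3) F) x) * (N : ℚ) := by
  rw [← card_group]
  have := Fintype.ofFinite (MulAction.orbit (GL (Fin 2) F × GL (Fin 3) F) x)
  have := MulAction.card_orbit_mul_card_stabilizer_eq_card_group
    (GL (Fin 2) F × GL (Fin 3) F) x
  rw [← Nat.card_eq_fintype_card, ← Nat.card_eq_fintype_card, ← Nat.card_eq_fintype_card] at this
  rw [← this]
  exact_mod_cast Nat.mul_le_mul_left _ h

lemma mem_pencilStabilizer_iff (A B : Fin 6 → F) (h : Matrix (Fin 3) (Fin 3) F) :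
    h ∈ pencilStabilizer A B ↔ h.det ≠ 0 ∧
      (∃ a b : F, formEval A (h 0) = a * A 0 + b * B 0 ∧
        formPolar A (h 0) (h 1) = a * A 1 + b * B 1 ∧
        formPolar A (h 0) (h 2) = a * A 2 + b * B 2 ∧
        formEval A (h 1) = a * A 3 + b * B 3 ∧
        formPolar A (h 1) (h 2) = a * A 4 + b * B 4 ∧
        formEval A (h 2) = a * A 5 + b * B 5) ∧
      (∃ a b : F, formEval B (h 0) = a * A 0 + b * B 0 ∧
        formPolar B (h 0) (h 1) = a * A 1 + b * B 1 ∧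
        formPolar B (h 0) (h 2) = a * A 2 + b * B 2 ∧
        formEval B (h 1) = a * A 3 + b * B 3 ∧
        formPolar B (h 1) (h 2) = a * A 4 + b * B 4 ∧
        formEval B (h 2) = a * A 5 + b * B 5) := by
  simp [pencilStabilizer, formSubst, funext_iff, Fin.forall_fin_succ]

lemma mem_lineStabilizer_iff (B : Fin 6 → F) (h : Matrix (Fin 3) (Fin 3) F) :
    h ∈ lineStabilizer B ↔ h.det ≠ 0 ∧
      (∃ a : F, formEval B (h 0) = a * B 0 ∧
        formPolar B (h 0) (h 1) = a * B 1 ∧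
        formPolar B (h 0) (h 2) = a * B 2 ∧
        formEval B (h 1) = a * B 3 ∧
        formPolar B (h 1) (h 2) = a * B 4 ∧
        formEval B (h 2) = a * B 5) := by
  simp [lineStabilizer, formSubst, funext_iff, Fin.forall_fin_succ]

lemma card_erase_zero_prod :
    ((Finset.univ : Finset (F × F)).erase 0).card = Fintype.card F ^ 2 - 1 := by
  rw [Finset.card_erase_of_mem (Finset.mem_univ _), Finset.card_univ, Fintype.card_prod, sq]

lemma card_pencilStabilizer_sq_mul :
    (pencilStabilizer ![0,0,0,0,0,1] ![0,0,0,0,1,0] : Finset (Matrix _ _ F)).card ≤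
      (Fintype.card F - 1) ^ 3 * Fintype.card F ^ 3 := by
  have key : ∀ h ∈ (pencilStabilizer ![0,0,0,0,0,1] ![0,0,0,0,1,0] : Finset (Matrix _ _ F)),
      h 0 2 = 0 ∧ h 1 2 = 0 ∧ h 0 1 = 0 ∧ h 0 0 ≠ 0 ∧ h 1 1 ≠ 0 ∧ h 2 2 ≠ 0 := by
    intro h hh
    simp [mem_pencilStabilizer_iff, formEval, formPolar, Matrix.det_fin_three] at hh
    grind
  refine (Finset.card_le_card_of_injOn
    (fun h => ((h 0 0, h 1 1, h 2 2), (h 1 0, h 2 0, h 2 1)))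
    (t := (Finset.univ.erase 0 ×ˢ Finset.univ.erase 0 ×ˢ Finset.univ.erase 0) ×ˢ
      (Finset.univ ×ˢ Finset.univ ×ˢ Finset.univ)) ?_ ?_).trans_eq ?_
  · intro h hh
    have := key h hh
    simp [this]
  · intro h hh h' hh' e
    have k := key h hh
    have k' := key h' hh'
    simp only [Prod.mk.injEq] at e
    ext i j
    fin_cases i <;> fin_cases j <;> simp [k, k', e]
  · simp only [Finset.card_product, card_erase_zero, Finset.card_univ]
    ring

lemma ne_zero_of_not_isSquare {l : F} (hl : ¬ IsSquare l) : l ≠ 0 := by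
  rintro rfl
  exact hl (IsSquare.zero)

lemma two_ne_zero_of_not_isSquare {l : F} (hl : ¬ IsSquare l) : (2 : F) ≠ 0 := by
  intro h
  have : ringChar F = 2 := by
    have := (ringChar.spec F 2).mp (by exact_mod_cast h)
    exact ((Nat.dvd_prime Nat.prime_two).mp this).resolve_left (CharP.ringChar_ne_one)
  exact hl (FiniteField.isSquare_of_char_two this l)

lemma eq_zero_of_sq_eq_mul_sq {l : F} (hl : ¬ IsSquare l) {x y : F} (h : x ^ 2 = l * y ^ 2) :
    x = 0 ∧ y = 0 := by
  by_cases hy : y = 0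
  · subst hy
    simpa using h
  · refine (hl ⟨x / y, ?_⟩).elim
    field_simp
    exact h.symm

/-- If `x' + y'√l` is orthogonal to `x + y√l` with norm `-l` times as large, then it is
`±√l (x + y√l)`. -/
lemma eq_or_eq_neg_of_norm {l x y x' y' : F} (hl : l ≠ 0) (hN : x ^ 2 - l * y ^ 2 ≠ 0)
    (h1 : x * x' = l * y * y') (h2 : x' ^ 2 - l * y' ^ 2 = -l * (x ^ 2 - l * y ^ 2)) :
    (x' = l * y ∧ y' = x) ∨ (x' = -(l * y) ∧ y' = -x) := by
  obtain ⟨t, ht⟩ : ∃ t, x * y' - x' * y = t * (x ^ 2 - l * y ^ 2) :=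
    ⟨(x * y' - x' * y) / (x ^ 2 - l * y ^ 2), (div_mul_cancel₀ _ hN).symm⟩
  have hx : x' = t * (l * y) := mul_right_cancel₀ hN (by linear_combination x * h1 + l * y * ht)
  have hy : y' = t * x := mul_right_cancel₀ hN (by linear_combination y * h1 + x * ht)
  have ht2 : t ^ 2 = 1 :=
    mul_right_cancel₀ (mul_ne_zero hl hN) (by rw [hx, hy] at h2; linear_combination -h2)
  rcases (by simpa using ht2 : t = 1 ∨ t = -1) with rfl | rfl
  · left; simp [hx, hy]
  · right; simp [hx, hy]

lemma card_det_ne_zero :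
    ({m | m.det ≠ 0} : Finset (Matrix (Fin 2) (Fin 2) F)).card =
      (Fintype.card F ^ 2 - 1) * (Fintype.card F ^ 2 - Fintype.card F) := by
  have := Matrix.card_GL_field (𝔽 := F) 2
  simp only [Fin.prod_univ_two, Fin.val_zero, Fin.val_one, pow_zero, pow_one] at this
  rw [← this, ← Nat.card_eq_finsetCard]
  refine Nat.card_congr ⟨fun m => Matrix.GeneralLinearGroup.mkOfDetNeZero m.1
    (by have := m.2; simp only [Finset.mem_filter] at this; exact this.2),
    fun g => ⟨g.1, by simpa using g.det.ne_zero⟩, fun m => rfl, fun g => Units.ext rfl⟩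

lemma card_lineStabilizer_mul :
    (lineStabilizer ![0,0,0,0,1,0] : Finset (Matrix _ _ F)).card ≤
      2 * (Fintype.card F - 1) ^ 3 * Fintype.card F ^ 2 := by
  have key : ∀ h ∈ (lineStabilizer ![0,0,0,0,1,0] : Finset (Matrix _ _ F)),
      h 0 1 = 0 ∧ h 0 2 = 0 ∧ h 0 0 ≠ 0 ∧ ((h 1 2 = 0 ∧ h 2 1 = 0 ∧ h 1 1 ≠ 0 ∧ h 2 2 ≠ 0) ∨
        (h 1 1 = 0 ∧ h 2 2 = 0 ∧ h 1 2 ≠ 0 ∧ h 2 1 ≠ 0)) := by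
    intro h hh
    simp [mem_lineStabilizer_iff, formEval, formPolar, Matrix.det_fin_three] at hh
    grind
  refine (Finset.card_le_card_of_injOn
    (fun h => (decide (h 1 1 = 0), h 0 0, h 1 1 + h 1 2, h 2 1 + h 2 2, h 1 0, h 2 0))
    (t := Finset.univ ×ˢ Finset.univ.erase 0 ×ˢ Finset.univ.erase 0 ×ˢ Finset.univ.erase 0 ×ˢ
      Finset.univ ×ˢ Finset.univ)
    ?_ ?_).trans ?_
  · intro h hh
    have := key h hh
    simp; grind
  · intro h hh h' hh' e
    have k := key h hh
    have k' := key h' hh'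
    clear key
    simp only [Prod.mk.injEq] at e
    ext i j
    fin_cases i <;> fin_cases j <;> simp <;> grind
  · simp only [Finset.card_product, card_erase_zero, Finset.card_univ,
      Fintype.card_bool]
    exact le_of_eq (by ring)

lemma card_lineStabilizer_norm (l : F) (hl : ¬ IsSquare l) :
    (lineStabilizer ![0,0,0,1,0,-l] : Finset (Matrix _ _ F)).card ≤
      2 * (Fintype.card F ^ 2 - 1) * (Fintype.card F - 1) * Fintype.card F ^ 2 := by
  have key : ∀ h ∈ (lineStabilizer ![0,0,0,1,0,-l] : Finset (Matrix _ _ F)),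
      h 0 1 = 0 ∧ h 0 2 = 0 ∧ h 0 0 ≠ 0 ∧ (h 1 1 = 0 → h 1 2 ≠ 0) ∧
        ((h 2 1 = l * h 1 2 ∧ h 2 2 = h 1 1) ∨ (h 2 1 = -(l * h 1 2) ∧ h 2 2 = -h 1 1)) := by
    intro h hh
    rw [mem_lineStabilizer_iff] at hh
    obtain ⟨hd, a, e0, e1, e2, e3, e4, e5⟩ := hh
    have h2 := two_ne_zero_of_not_isSquare hl
    simp [formEval, formPolar, Matrix.det_fin_three] at hd e0 e1 e2 e3 e4 e5
    obtain ⟨h01, h02⟩ := eq_zero_of_sq_eq_mul_sq hl (x := h 0 1) (y := h 0 2)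
      (by linear_combination e0)
    simp only [h01, h02] at *
    have h12 : h 1 1 = 0 → h 1 2 ≠ 0 := by grind
    refine ⟨trivial, trivial, by grind, h12, eq_or_eq_neg_of_norm
      (ne_zero_of_not_isSquare hl) ?_ ?_ ?_⟩
    · intro h0
      have := eq_zero_of_sq_eq_mul_sq hl (x := h 1 1) (y := h 1 2) (by linear_combination h0)
      exact h12 this.1 this.2
    · grind
    · linear_combination e5 + l * e3
  refine (Finset.card_le_card_of_injOn
    (fun h => (decide (h 2 1 = l * h 1 2 ∧ h 2 2 = h 1 1), (h 1 1, h 1 2), h 0 0, h 1 0, h 2 0))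
    (t := Finset.univ ×ˢ Finset.univ.erase 0 ×ˢ Finset.univ.erase 0 ×ˢ
      Finset.univ ×ˢ Finset.univ)
    ?_ ?_).trans ?_
  · intro h hh
    have := key h hh
    simp; grind
  · intro h hh h' hh' e
    have k := key h hh
    have k' := key h' hh'
    clear key
    simp only [Prod.mk.injEq] at e
    ext i j
    fin_cases i <;> fin_cases j <;> simp <;> grind
  · simp only [Finset.card_product, card_erase_zero, card_erase_zero_prod, Finset.card_univ,
      Fintype.card_bool]
    exact le_of_eq (by ring)

lemma card_pencilStabilizer_mul_mul :
    (pencilStabilizer ![0,0,0,0,1,0] ![0,0,1,0,0,0] : Finset (Matrix _ _ F)).card ≤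
      ((Fintype.card F ^ 2 - 1) * (Fintype.card F ^ 2 - Fintype.card F)) *
        (Fintype.card F - 1) := by
  have key : ∀ h ∈ (pencilStabilizer ![0,0,0,0,1,0] ![0,0,1,0,0,0] : Finset (Matrix _ _ F)),
      h 0 2 = 0 ∧ h 1 2 = 0 ∧ h 2 0 = 0 ∧ h 2 1 = 0 ∧ h 2 2 ≠ 0 ∧
        h 0 0 * h 1 1 - h 0 1 * h 1 0 ≠ 0 := by
    intro h hh
    simp [mem_pencilStabilizer_iff, formEval, formPolar, Matrix.det_fin_three] at hh
    grind
  refine (Finset.card_le_card_of_injOn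
    (fun h => (!![h 0 0, h 0 1; h 1 0, h 1 1], h 2 2))
    (t := ({m | m.det ≠ 0} : Finset (Matrix (Fin 2) (Fin 2) F)) ×ˢ Finset.univ.erase 0)
    ?_ ?_).trans ?_
  · intro h hh
    have := key h hh
    simp [this, Matrix.det_fin_two]
  · intro h hh h' hh' e
    have k := key h hh
    have k' := key h' hh'
    clear key
    simp at e
    ext i j
    fin_cases i <;> fin_cases j <;> simp <;> grind
  · simp only [Finset.card_product, card_erase_zero, card_det_ne_zero]
    exact le_of_eq (by ring)

lemma card_lineStabilizer_sq :
    (lineStabilizer ![0,0,0,0,0,1] : Finset (Matrix _ _ F)).card ≤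
      ((Fintype.card F ^ 2 - 1) * (Fintype.card F ^ 2 - Fintype.card F)) *
        (Fintype.card F - 1) * Fintype.card F ^ 2 := by
  have key : ∀ h ∈ (lineStabilizer ![0,0,0,0,0,1] : Finset (Matrix _ _ F)),
      h 0 2 = 0 ∧ h 1 2 = 0 ∧ h 2 2 ≠ 0 ∧
        h 0 0 * h 1 1 - h 0 1 * h 1 0 ≠ 0 := by
    intro h hh
    simp [mem_lineStabilizer_iff, formEval, formPolar, Matrix.det_fin_three] at hh
    grind
  refine (Finset.card_le_card_of_injOn
    (fun h => (!![h 0 0, h 0 1; h 1 0, h 1 1], h 2 2, h 2 0, h 2 1))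
    (t := ({m | m.det ≠ 0} : Finset (Matrix (Fin 2) (Fin 2) F)) ×ˢ
      Finset.univ.erase 0 ×ˢ Finset.univ ×ˢ Finset.univ)
    ?_ ?_).trans ?_
  · intro h hh
    have := key h hh
    simp [this, Matrix.det_fin_two]
  · intro h hh h' hh' e
    have k := key h hh
    have k' := key h' hh'
    clear key
    simp at e
    ext i j
    fin_cases i <;> fin_cases j <;> simp <;> grind
  · simp only [Finset.card_product, card_erase_zero, card_det_ne_zero, Finset.card_univ]
    exact le_of_eq (by ring)

lemma card_pencilStabilizer_sq_sq (h2 : (2 : F) ≠ 0) :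
    (pencilStabilizer ![0,0,0,0,0,1] ![0,0,0,1,0,0] : Finset (Matrix _ _ F)).card ≤
      2 * (Fintype.card F - 1) ^ 3 * Fintype.card F ^ 2 := by
  have key : ∀ h ∈ (pencilStabilizer ![0,0,0,0,0,1] ![0,0,0,1,0,0] : Finset (Matrix _ _ F)),
      h 0 1 = 0 ∧ h 0 2 = 0 ∧ h 0 0 ≠ 0 ∧ ((h 1 2 = 0 ∧ h 2 1 = 0 ∧ h 1 1 ≠ 0 ∧ h 2 2 ≠ 0) ∨
        (h 1 1 = 0 ∧ h 2 2 = 0 ∧ h 1 2 ≠ 0 ∧ h 2 1 ≠ 0)) := by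
    intro h hh
    simp [mem_pencilStabilizer_iff, formEval, formPolar, Matrix.det_fin_three] at hh
    grind
  refine (Finset.card_le_card_of_injOn
    (fun h => (decide (h 1 1 = 0), h 0 0, h 1 1 + h 1 2, h 2 1 + h 2 2, h 1 0, h 2 0))
    (t := Finset.univ ×ˢ Finset.univ.erase 0 ×ˢ Finset.univ.erase 0 ×ˢ Finset.univ.erase 0 ×ˢ
      Finset.univ ×ˢ Finset.univ)
    ?_ ?_).trans ?_
  · intro h hh
    have := key h hh
    simp; grind
  · intro h hh h' hh' e
    have k := key h hh
    have k' := key h' hh'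
    clear key
    simp only [Prod.mk.injEq] at e
    ext i j
    fin_cases i <;> fin_cases j <;> simp <;> grind
  · simp only [Finset.card_product, card_erase_zero, Finset.card_univ,
      Fintype.card_bool]
    exact le_of_eq (by ring)

lemma card_pencilStabilizer_mul_norm (l : F) (hl : ¬ IsSquare l) :
    (pencilStabilizer ![0,0,0,0,1,0] ![0,0,0,1,0,l] : Finset (Matrix _ _ F)).card ≤
      2 * (Fintype.card F ^ 2 - 1) * (Fintype.card F - 1) * Fintype.card F ^ 2 := by
  have key : ∀ h ∈ (pencilStabilizer ![0,0,0,0,1,0] ![0,0,0,1,0,l] : Finset (Matrix _ _ F)),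
      h 0 1 = 0 ∧ h 0 2 = 0 ∧ h 0 0 ≠ 0 ∧ (h 2 1 = 0 → h 1 1 ≠ 0) ∧
        ((l * h 2 2 = l * h 1 1 ∧ l * h 1 2 = h 2 1) ∨
          (l * h 2 2 = -(l * h 1 1) ∧ l * h 1 2 = -h 2 1)) := by
    intro h hh
    rw [mem_pencilStabilizer_iff] at hh
    obtain ⟨hd, ⟨a, b, e0, e1, e2, e3, e4, e5⟩, a', b', f0, f1, f2, f3, f4, f5⟩ := hh
    simp [formEval, formPolar, Matrix.det_fin_three] at hd e0 e1 e2 e3 e4 e5 f0 f1 f2 f3 f4 f5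
    have l0 := ne_zero_of_not_isSquare hl
    obtain ⟨h01, h02⟩ : h 0 1 = 0 ∧ h 0 2 = 0 := by grind
    simp only [h01, h02] at *
    have h12 : h 2 1 = 0 → h 1 1 ≠ 0 := by grind
    refine ⟨trivial, trivial, by grind, h12, eq_or_eq_neg_of_norm l0 ?_ ?_ ?_⟩
    · intro h0
      have := eq_zero_of_sq_eq_mul_sq hl (x := h 2 1) (y := h 1 1) (by linear_combination h0)
      exact h12 this.1 this.2
    · grind
    · grind
  refine (Finset.card_le_card_of_injOn
    (fun h => (decide (l * h 2 2 = l * h 1 1 ∧ l * h 1 2 = h 2 1), (h 2 1, h 1 1), h 0 0, h 1 0,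
      h 2 0))
    (t := Finset.univ ×ˢ Finset.univ.erase 0 ×ˢ Finset.univ.erase 0 ×ˢ
      Finset.univ ×ˢ Finset.univ)
    ?_ ?_).trans ?_
  · intro h hh
    have := key h hh
    simp; grind
  · intro h hh h' hh' e
    have k := key h hh
    have k' := key h' hh'
    clear key
    simp only [Prod.mk.injEq] at e
    ext i j
    fin_cases i <;> fin_cases j <;> simp <;> grind [ne_zero_of_not_isSquare hl]
  · simp only [Finset.card_product, card_erase_zero, card_erase_zero_prod, Finset.card_univ,
      Fintype.card_bool]
    exact le_of_eq (by ring)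

lemma card_pencilStabilizer_sq_conic (h2 : (2 : F) ≠ 0) :
    (pencilStabilizer ![0,0,0,0,0,1] ![0,0,1,1,0,0] : Finset (Matrix _ _ F)).card ≤
      (Fintype.card F - 1) ^ 2 * Fintype.card F ^ 2 := by
  have key : ∀ h ∈ (pencilStabilizer ![0,0,0,0,0,1] ![0,0,1,1,0,0] : Finset (Matrix _ _ F)),
      h 0 2 = 0 ∧ h 1 2 = 0 ∧ h 0 1 = 0 ∧ h 1 1 ≠ 0 ∧ h 2 2 ≠ 0 ∧ h 2 2 * h 0 0 = h 1 1 ^ 2 ∧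
        h 2 2 * h 1 0 + 2 * h 1 1 * h 2 1 = 0 := by
    intro h hh
    simp [mem_pencilStabilizer_iff, formEval, formPolar, Matrix.det_fin_three] at hh
    grind
  refine (Finset.card_le_card_of_injOn
    (fun h => (h 1 1, h 2 2, h 2 0, h 2 1))
    (t := Finset.univ.erase 0 ×ˢ Finset.univ.erase 0 ×ˢ
      Finset.univ ×ˢ Finset.univ)
    ?_ ?_).trans ?_
  · intro h hh
    have := key h hh
    simp [this]
  · intro h hh h' hh' e
    have k := key h hh
    have k' := key h' hh'
    clear key
    simp only [Prod.mk.injEq] at e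
    ext i j
    fin_cases i <;> fin_cases j <;> simp <;> grind
  · simp only [Finset.card_product, card_erase_zero, Finset.card_univ]
    exact le_of_eq (by ring)

lemma card_pencilStabilizer_mul_conic :
    (pencilStabilizer ![0,0,0,0,1,0] ![0,0,1,1,0,0] : Finset (Matrix _ _ F)).card ≤
      (Fintype.card F - 1) ^ 2 * Fintype.card F := by
  have key : ∀ h ∈ (pencilStabilizer ![0,0,0,0,1,0] ![0,0,1,1,0,0] : Finset (Matrix _ _ F)),
      h 0 1 = 0 ∧ h 0 2 = 0 ∧ h 1 2 = 0 ∧ h 2 1 = 0 ∧ h 2 0 = 0 ∧ h 1 1 ≠ 0 ∧ h 2 2 ≠ 0 ∧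
        h 2 2 * h 0 0 = h 1 1 ^ 2 := by
    intro h hh
    rw [mem_pencilStabilizer_iff] at hh
    obtain ⟨hd, ⟨a, b, e0, e1, e2, e3, e4, e5⟩, a', b', f0, f1, f2, f3, f4, f5⟩ := hh
    simp [formEval, formPolar, Matrix.det_fin_three] at hd e0 e1 e2 e3 e4 e5 f0 f1 f2 f3 f4 f5
    have h01 : h 0 1 = 0 := by
      rcases e0 with e | e
      · exact e
      · simpa [e] using f0
    have h02 : h 0 2 = 0 := by
      by_contra n
      simp [h01, n] at f0 e1 e2 e3
      grind
    simp only [h01, h02] at *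
    obtain ⟨h12, h21⟩ : h 1 2 = 0 ∧ h 2 1 = 0 := by grind
    simp only [h12, h21] at *
    grind
  refine (Finset.card_le_card_of_injOn
    (fun h => (h 1 1, h 2 2, h 1 0))
    (t := Finset.univ.erase 0 ×ˢ Finset.univ.erase 0 ×ˢ Finset.univ)
    ?_ ?_).trans ?_
  · intro h hh
    have := key h hh
    simp [this]
  · intro h hh h' hh' e
    have k := key h hh
    have k' := key h' hh'
    clear key
    simp only [Prod.mk.injEq] at e
    ext i j
    fin_cases i <;> fin_cases j <;> simp <;> grind
  · simp only [Finset.card_product, card_erase_zero, Finset.card_univ]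
    exact le_of_eq (by ring)

lemma card_pencilStabilizer_sq_split (h2 : (2 : F) ≠ 0) :
    (pencilStabilizer ![0,0,0,0,0,1] ![1,0,0,-1,0,0] : Finset (Matrix _ _ F)).card ≤
      2 * (Fintype.card F - 1) ^ 3 := by
  have key : ∀ h ∈ (pencilStabilizer ![0,0,0,0,0,1] ![1,0,0,-1,0,0] : Finset (Matrix _ _ F)),
      h 0 2 = 0 ∧ h 1 2 = 0 ∧ h 2 0 = 0 ∧ h 2 1 = 0 ∧ h 2 2 ≠ 0 ∧ h 0 0 + h 0 1 ≠ 0 ∧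
        h 0 0 - h 0 1 ≠ 0 ∧
        ((h 1 0 = 1 * h 0 1 ∧ h 1 1 = h 0 0) ∨ (h 1 0 = -(1 * h 0 1) ∧ h 1 1 = -h 0 0)) := by
    intro h hh
    rw [mem_pencilStabilizer_iff] at hh
    obtain ⟨hd, ⟨a, b, e0, e1, e2, e3, e4, e5⟩, a', b', f0, f1, f2, f3, f4, f5⟩ := hh
    simp [formEval, formPolar, Matrix.det_fin_three] at hd e0 e1 e2 e3 e4 e5 f0 f1 f2 f3 f4 f5
    have h02 : h 0 2 = 0 := by
      by_contra n
      have h12 : h 1 2 = 0 := by simpa [h2, n] using e1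
      simp [h12] at e3
      simp [e3, n] at e0
    have h12 : h 1 2 = 0 := by
      simp [h02] at e0
      simpa [← e0] using e3
    simp only [h02, h12] at *
    obtain ⟨h20, h21⟩ : h 2 0 = 0 ∧ h 2 1 = 0 := by grind
    simp only [h20, h21] at *
    have hn : h 0 0 ^ 2 - 1 * h 0 1 ^ 2 ≠ 0 := by grind
    exact ⟨trivial, trivial, trivial, trivial, by grind, by grind, by grind,
      eq_or_eq_neg_of_norm one_ne_zero hn (by grind) (by grind)⟩
  refine (Finset.card_le_card_of_injOn
    (fun h => (decide (h 1 0 = 1 * h 0 1 ∧ h 1 1 = h 0 0), h 2 2, h 0 0 + h 0 1, h 0 0 - h 0 1))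
    (t := Finset.univ ×ˢ Finset.univ.erase 0 ×ˢ Finset.univ.erase 0 ×ˢ Finset.univ.erase 0)
    ?_ ?_).trans ?_
  · intro h hh
    have := key h hh
    simp [this]; tauto
  · intro h hh h' hh' e
    have k := key h hh
    have k' := key h' hh'
    clear key
    simp only [Prod.mk.injEq] at e
    ext i j
    fin_cases i <;> fin_cases j <;> simp <;> grind
  · simp only [Finset.card_product, card_erase_zero, Finset.card_univ,
      Fintype.card_bool]
    exact le_of_eq (by ring)

lemma card_pencilStabilizer_sq_norm (h2 : (2 : F) ≠ 0) (l : F) (hl : ¬ IsSquare l) :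
    (pencilStabilizer ![0,0,0,0,0,1] ![1,0,0,-l,0,0] : Finset (Matrix _ _ F)).card ≤
      2 * (Fintype.card F - 1) * (Fintype.card F ^ 2 - 1) := by
  have key : ∀ h ∈ (pencilStabilizer ![0,0,0,0,0,1] ![1,0,0,-l,0,0] : Finset (Matrix _ _ F)),
      h 0 2 = 0 ∧ h 1 2 = 0 ∧ h 2 0 = 0 ∧ h 2 1 = 0 ∧ h 2 2 ≠ 0 ∧ (h 0 0 = 0 → h 0 1 ≠ 0) ∧
        ((h 1 0 = l * h 0 1 ∧ h 1 1 = h 0 0) ∨ (h 1 0 = -(l * h 0 1) ∧ h 1 1 = -h 0 0)) := by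
    intro h hh
    rw [mem_pencilStabilizer_iff] at hh
    obtain ⟨hd, ⟨a, b, e0, e1, e2, e3, e4, e5⟩, a', b', f0, f1, f2, f3, f4, f5⟩ := hh
    simp [formEval, formPolar, Matrix.det_fin_three] at hd e0 e1 e2 e3 e4 e5 f0 f1 f2 f3 f4 f5
    have l0 := ne_zero_of_not_isSquare hl
    have h02 : h 0 2 = 0 := by
      by_contra n
      have h12 : h 1 2 = 0 := by simpa [h2, n] using e1
      simp [h12, l0] at e3
      simp [e3, n] at e0
    have h12 : h 1 2 = 0 := by
      simp [h02] at e0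
      simpa [← e0] using e3
    simp only [h02, h12] at *
    obtain ⟨h20, h21⟩ : h 2 0 = 0 ∧ h 2 1 = 0 := by grind
    simp only [h20, h21] at *
    have h0 : h 0 0 = 0 → h 0 1 ≠ 0 := by grind
    have hn : h 0 0 ^ 2 - l * h 0 1 ^ 2 ≠ 0 := by
      intro hn
      have := eq_zero_of_sq_eq_mul_sq hl (x := h 0 0) (y := h 0 1) (by linear_combination hn)
      exact h0 this.1 this.2
    exact ⟨trivial, trivial, trivial, trivial, by grind, h0,
      eq_or_eq_neg_of_norm l0 hn (by grind) (by grind)⟩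
  refine (Finset.card_le_card_of_injOn
    (fun h => (decide (h 1 0 = l * h 0 1 ∧ h 1 1 = h 0 0), h 2 2, (h 0 0, h 0 1)))
    (t := Finset.univ ×ˢ Finset.univ.erase 0 ×ˢ Finset.univ.erase 0)
    ?_ ?_).trans ?_
  · intro h hh
    have := key h hh
    simp; grind
  · intro h hh h' hh' e
    have k := key h hh
    have k' := key h' hh'
    clear key
    simp only [Prod.mk.injEq] at e
    ext i j
    fin_cases i <;> fin_cases j <;> simp <;> grind
  · simp only [Finset.card_product, card_erase_zero, card_erase_zero_prod, Finset.card_univ,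
      Fintype.card_bool]
    exact le_of_eq (by ring)

lemma card_pencilStabilizer_split_mul (h2 : (2 : F) ≠ 0) :
    (pencilStabilizer ![0,0,0,1,0,-1] ![0,0,1,0,0,0] : Finset (Matrix _ _ F)).card ≤
      2 * (Fintype.card F - 1) ^ 2 := by
  have key : ∀ h ∈ (pencilStabilizer ![0,0,0,1,0,-1] ![0,0,1,0,0,0] : Finset (Matrix _ _ F)),
      h 0 1 = 0 ∧ h 0 2 = 0 ∧ h 1 0 = 0 ∧ h 1 2 = 0 ∧ h 2 0 = 0 ∧ h 2 1 = 0 ∧ h 0 0 ≠ 0 ∧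
        h 2 2 ≠ 0 ∧
        (h 1 1 = h 2 2 ∨ h 1 1 = -h 2 2) := by
    intro h hh
    simp [mem_pencilStabilizer_iff, formEval, formPolar, Matrix.det_fin_three] at hh
    grind
  refine (Finset.card_le_card_of_injOn
    (fun h => (decide (h 1 1 = h 2 2), h 0 0, h 2 2))
    (t := Finset.univ ×ˢ Finset.univ.erase 0 ×ˢ Finset.univ.erase 0)
    ?_ ?_).trans ?_
  · intro h hh
    have := key h hh
    simp [this]; tauto
  · intro h hh h' hh' e
    have k := key h hh
    have k' := key h' hh'
    clear key
    simp only [Prod.mk.injEq] at e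
    ext i j
    fin_cases i <;> fin_cases j <;> simp <;> grind
  · simp only [Finset.card_product, card_erase_zero, Finset.card_univ,
      Fintype.card_bool]
    exact le_of_eq (by ring)

lemma card_pencilStabilizer_norm_mul (h2 : (2 : F) ≠ 0) (l : F) (hl : ¬ IsSquare l) :
    (pencilStabilizer ![0,0,0,1,0,-l] ![0,0,1,0,0,0] : Finset (Matrix _ _ F)).card ≤
      2 * (Fintype.card F - 1) ^ 2 := by
  have key : ∀ h ∈ (pencilStabilizer ![0,0,0,1,0,-l] ![0,0,1,0,0,0] : Finset (Matrix _ _ F)),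
      h 0 1 = 0 ∧ h 0 2 = 0 ∧ h 1 0 = 0 ∧ h 1 2 = 0 ∧ h 2 0 = 0 ∧ h 2 1 = 0 ∧ h 0 0 ≠ 0 ∧
        h 2 2 ≠ 0 ∧
        (h 1 1 = h 2 2 ∨ h 1 1 = -h 2 2) := by
    intro h hh
    simp [mem_pencilStabilizer_iff, formEval, formPolar, Matrix.det_fin_three] at hh
    have l0 := ne_zero_of_not_isSquare hl
    have := eq_zero_of_sq_eq_mul_sq hl (x := h 0 1) (y := h 0 2)
    grind
  refine (Finset.card_le_card_of_injOn
    (fun h => (decide (h 1 1 = h 2 2), h 0 0, h 2 2))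
    (t := Finset.univ ×ˢ Finset.univ.erase 0 ×ˢ Finset.univ.erase 0)
    ?_ ?_).trans ?_
  · intro h hh
    have := key h hh
    simp [this]; tauto
  · intro h hh h' hh' e
    have k := key h hh
    have k' := key h' hh'
    clear key
    simp only [Prod.mk.injEq] at e
    ext i j
    fin_cases i <;> fin_cases j <;> simp <;> grind
  · simp only [Finset.card_product, card_erase_zero, Finset.card_univ,
      Fintype.card_bool]
    exact le_of_eq (by ring)

lemma mul_inv_mem_lineStabilizer {B : Fin 6 → F} (hB : B ≠ 0) {g h : Matrix (Fin 3) (Fin 3) F}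
    (hg : g ∈ lineStabilizer B) (hh : h ∈ lineStabilizer B) : g * h⁻¹ ∈ lineStabilizer B := by
  simp only [lineStabilizer, Finset.mem_filter, Finset.mem_univ, true_and] at *
  obtain ⟨hg, a, ha⟩ := hg
  obtain ⟨hh, b, hb⟩ := hh
  have hu : IsUnit h.det := hh.isUnit
  have h1 := congrArg (formSubst h⁻¹) hb
  rw [← formSubst_mul, Matrix.nonsing_inv_mul _ hu, formSubst_one, formSubst_smul] at h1
  have hb0 : b ≠ 0 := by
    rintro rfl
    exact hB (by simpa using h1)
  refine ⟨?_, a * b⁻¹, ?_⟩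
  · rw [Matrix.det_mul]
    exact mul_ne_zero hg (by simpa [Matrix.det_nonsing_inv] using hh)
  · have h2 : formSubst h⁻¹ B = b⁻¹ • B := by
      conv_rhs => rw [h1]
      rw [smul_smul, inv_mul_cancel₀ hb0, one_smul]
    rw [formSubst_mul, h2, formSubst_smul, ha, smul_smul, mul_comm]

lemma card_lineStabilizer_conic :
    (lineStabilizer ![1,0,0,0,-1,0] : Finset (Matrix _ _ F)).card ≤
      (Fintype.card F - 1) * Fintype.card F * (Fintype.card F ^ 2 - 1) := by
  have hB : (![1,0,0,0,-1,0] : Fin 6 → F) ≠ 0 := fun h => by simpa using congrFun h 0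
  set S : Finset (Matrix (Fin 3) (Fin 3) F) := lineStabilizer ![1,0,0,0,-1,0] with hS
  have isotropic : ∀ h ∈ S, h 1 0 ^ 2 = h 1 1 * h 1 2 ∧ (h 1 1 = 0 → h 1 2 ≠ 0) := by
    intro h hh
    rw [hS, mem_lineStabilizer_iff] at hh
    obtain ⟨hd, a, -, -, -, e3, -, -⟩ := hh
    simp [formEval, Matrix.det_fin_three] at hd e3
    grind
  have unipotent : (S.filter fun k => k 1 = ![0, 1, 0]).card ≤
      (Fintype.card F - 1) * Fintype.card F := by
    have key : ∀ k ∈ S.filter fun k => k 1 = ![0, 1, 0],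
        k 1 0 = 0 ∧ k 1 1 = 1 ∧ k 1 2 = 0 ∧ k 0 2 = 0 ∧ k 0 0 ≠ 0 ∧ k 2 2 = k 0 0 ^ 2 ∧
          k 0 1 * k 2 2 = 2 * k 0 0 * k 2 0 ∧ k 2 1 * k 2 2 = k 2 0 ^ 2 := by
      intro k hk
      rw [Finset.mem_filter, hS, mem_lineStabilizer_iff] at hk
      obtain ⟨⟨hd, a, e0, e1, e2, e3, e4, e5⟩, hk⟩ := hk
      have k0 := congrFun hk 0
      have k1 := congrFun hk 1
      have k2 := congrFun hk 2
      simp [formEval, formPolar, Matrix.det_fin_three] at hd e0 e1 e2 e3 e4 e5 k0 k1 k2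
      simp only [k0, k1, k2] at *
      grind
    refine (Finset.card_le_card_of_injOn (fun k => (k 0 0, k 2 0))
      (t := Finset.univ.erase 0 ×ˢ Finset.univ) ?_ ?_).trans_eq ?_
    · intro k hk
      simp [key k hk]
    · intro k hk k' hk' e
      have h1 := key k hk
      have h2 := key k' hk'
      clear key
      simp only [Prod.mk.injEq] at e
      ext i j
      fin_cases i <;> fin_cases j <;> simp <;> grind
    · rw [Finset.card_product, card_erase_zero, Finset.card_univ]
  let f : Matrix (Fin 3) (Fin 3) F → F × F := fun h =>
    if h 1 2 = 0 then (0, h 1 1) else (h 1 2, h 1 0)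
  have hf : ∀ h ∈ S, ∀ h' ∈ S, f h = f h' → h 1 = h' 1 := by
    intro h hh h' hh' e
    have i := isotropic h hh
    have i' := isotropic h' hh'
    clear isotropic
    simp only [f] at e
    ext j
    fin_cases j <;> simp <;> grind
  calc S.card ≤ (Fintype.card F - 1) * Fintype.card F * (S.image f).card := by
        refine Finset.card_le_mul_card_image _ _ fun p hp => ?_
        obtain ⟨h₀, hh₀, rfl⟩ := Finset.mem_image.mp hp
        refine le_trans ?_ unipotent
        have hu : IsUnit h₀.det := by
          have := (mem_lineStabilizer_iff _ _).mp hh₀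
          exact this.1.isUnit
        refine Finset.card_le_card_of_injOn (fun h => h * h₀⁻¹) ?_ ?_
        · intro h hh
          simp only [Finset.coe_filter, Set.mem_ofPred_eq] at hh ⊢
          refine ⟨mul_inv_mem_lineStabilizer hB hh.1 hh₀, ?_⟩
          have e1 : (h * h₀⁻¹) 1 = (h₀ * h₀⁻¹) 1 := by
            change h 1 ᵥ* h₀⁻¹ = h₀ 1 ᵥ* h₀⁻¹
            rw [hf h hh.1 h₀ hh₀ hh.2]
          rw [e1, Matrix.mul_nonsing_inv _ hu]
          funext j
          fin_cases j
          · simp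
          · exact Matrix.one_apply_eq 1
          · simp
        · intro h _ h' _ e
          have := congrArg (· * h₀) e
          simpa [mul_assoc, Matrix.nonsing_inv_mul _ hu] using this
    _ ≤ _ := by
        refine Nat.mul_le_mul_left _ ?_
        rw [← card_erase_zero_prod]
        refine Finset.card_le_card fun p hp => ?_
        obtain ⟨h, hh, rfl⟩ := Finset.mem_image.mp hp
        have := isotropic h hh
        simp only [f, Finset.mem_erase, Finset.mem_univ, and_true]
        split_ifs with h0
        · simp; grind
        · simp [h0]

section FourPoints

variable {K : Type*} [Field K]

/-- Four points of the projective plane, no three of which are collinear. -/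
def GeneralPosition (P : Fin 4 → Fin 3 → K) : Prop :=
  ∀ m : Fin 4, (Matrix.of fun k => P (m.succAbove k)).det ≠ 0

lemma GeneralPosition.ne_smul {P : Fin 4 → Fin 3 → K} (hP : GeneralPosition P) {i j : Fin 4}
    (hij : i ≠ j) (c : K) : P i ≠ c • P j := by
  intro h
  obtain ⟨m, hmi, hmj⟩ : ∃ m, m ≠ i ∧ m ≠ j := by
    clear h
    decide +revert
  obtain ⟨i', rfl⟩ := Fin.exists_succAbove_eq hmi.symm
  obtain ⟨j', rfl⟩ := Fin.exists_succAbove_eq hmj.symm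
  have hij' : i' ≠ j' := fun e => hij (e ▸ rfl)
  have hv : (Pi.single i' 1 - c • Pi.single j' 1 : Fin 3 → K) ᵥ*
      Matrix.of (fun k => P (m.succAbove k)) = 0 := by
    rw [Matrix.sub_vecMul, Matrix.smul_vecMul, Matrix.single_one_vecMul, Matrix.single_one_vecMul]
    exact sub_eq_zero.mpr h
  have := congrFun (Matrix.eq_zero_of_vecMul_eq_zero (hP m) hv) i'
  simp [hij'] at this

lemma GeneralPosition.ne_zero {P : Fin 4 → Fin 3 → K} (hP : GeneralPosition P) (i : Fin 4) :
    P i ≠ 0 := by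
  intro h
  obtain ⟨j, hj⟩ := exists_ne i
  exact hP.ne_smul hj.symm 0 (by simpa using h)

lemma GeneralPosition.eq_smul {P : Fin 4 → Fin 3 → K} (hP : GeneralPosition P)
    {g h : Matrix (Fin 3) (Fin 3) K} (hh : h.det ≠ 0) {d : Fin 4 → K}
    (hd : ∀ i, P i ᵥ* g = d i • (P i ᵥ* h)) : g = d 3 • h := by
  set M : Matrix (Fin 3) (Fin 3) K := Matrix.of ![P 0, P 1, P 2] with hM
  have hMdet : M.det ≠ 0 := by
    have := hP 3
    rwa [show (Matrix.of fun k => P ((3 : Fin 4).succAbove k)) = M by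
      ext i j; fin_cases i <;> rfl] at this
  obtain ⟨a, ha⟩ : ∃ a, a ᵥ* M = P 3 := ⟨P 3 ᵥ* M⁻¹, by
    rw [Matrix.vecMul_vecMul, Matrix.nonsing_inv_mul _ hMdet.isUnit, Matrix.vecMul_one]⟩
  have haj (j : Fin 3) : P 3 j = a 0 * P 0 j + a 1 * P 1 j + a 2 * P 2 j := by
    simp [← ha, Matrix.vecMul, dotProduct, Fin.sum_univ_three, hM]
  have ha0 (i : Fin 3) : a i ≠ 0 := by
    intro h0
    apply hP i.castSucc
    fin_cases i <;> simp at h0 <;>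
      simp [Matrix.det_fin_three, Fin.succAbove, Fin.lt_def, haj, h0] <;> ring
  have hMg (i : Fin 3) : (M * g) i = d i.castSucc • (M * h) i := by
    rw [Matrix.mul_apply_eq_vecMul, Matrix.mul_apply_eq_vecMul]
    fin_cases i
    exacts [hd 0, hd 1, hd 2]
  have hlin : (fun i => a i * (d i.castSucc - d 3)) ᵥ* (M * h) = 0 := by
    have h3 : a ᵥ* (M * g) = d 3 • (a ᵥ* (M * h)) := by
      rw [← Matrix.vecMul_vecMul, ← Matrix.vecMul_vecMul, ha]
      exact hd 3
    funext j
    have := congrFun h3 j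
    have e := fun i => congrFun (hMg i) j
    simp only [Matrix.vecMul, dotProduct, Fin.sum_univ_three, Pi.smul_apply, smul_eq_mul,
      Pi.zero_apply, e] at this ⊢
    linear_combination this
  have hdet : (M * h).det ≠ 0 := by
    rw [Matrix.det_mul]
    exact mul_ne_zero hMdet hh
  have hd3 (i : Fin 3) : d i.castSucc = d 3 := by
    have := congrFun (Matrix.eq_zero_of_vecMul_eq_zero hdet hlin) i
    simpa [ha0 i, sub_eq_zero] using this
  have : M * g = M * (d 3 • h) := by
    ext i j
    rw [hMg, hd3, Matrix.mul_smul]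
    rfl
  have hinv := congrArg (M⁻¹ * ·) this
  simpa [← mul_assoc, Matrix.nonsing_inv_mul _ hMdet.isUnit] using hinv

variable [Algebra F K]

lemma formSubst_map (g : Matrix (Fin 3) (Fin 3) F) (c : Fin 6 → F) :
    formSubst (g.map (algebraMap F K)) (algebraMap F K ∘ c) =
      algebraMap F K ∘ formSubst g c := by
  funext i
  have h2 : algebraMap F K 2 = 2 := map_ofNat _ 2
  fin_cases i <;> simp [formSubst, formEval, formPolar, Matrix.map_apply, h2]

/-- The common zeros of `A` and `B` over the extension `K` of `F` are the four points `P i` in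
general position, and the Frobenius acts on them by `τ`. -/
structure IsBaseLocus (A B : Fin 6 → F) (P : Fin 4 → Fin 3 → K) (τ : Fin 4 → Fin 4) : Prop where
  general : GeneralPosition P
  zero_left : ∀ i, formEval (algebraMap F K ∘ A) (P i) = 0
  zero_right : ∀ i, formEval (algebraMap F K ∘ B) (P i) = 0
  complete : ∀ v ≠ 0, formEval (algebraMap F K ∘ A) v = 0 → formEval (algebraMap F K ∘ B) v = 0 →
    ∃ i, ∃ c : K, v = c • P i
  frobenius : ∀ i, FiniteField.frobeniusAlgHom F K ∘ P i = P (τ i)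

namespace IsBaseLocus

variable {A B : Fin 6 → F} {P : Fin 4 → Fin 3 → K} {τ : Fin 4 → Fin 4}

lemma exists_permutation (hP : IsBaseLocus A B P τ) {h : Matrix (Fin 3) (Fin 3) F}
    (hh : h ∈ pencilStabilizer A B) :
    ∃ σ : Fin 4 → Fin 4, Function.Injective σ ∧ (∀ i, σ (τ i) = τ (σ i)) ∧
      ∀ i, ∃ c : K, c ≠ 0 ∧ P i ᵥ* h.map (algebraMap F K) = c • P (σ i) := by
  simp only [pencilStabilizer, Finset.mem_filter, Finset.mem_univ, true_and] at hh
  obtain ⟨hdet, ⟨a, b, hA⟩, a', b', hB⟩ := hh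
  set hK := h.map (algebraMap F K) with hhK
  have hdetK : hK.det ≠ 0 := by
    rw [hhK, ← RingHom.mapMatrix_apply, ← RingHom.map_det]
    simpa using hdet
  have inj (v : Fin 3 → K) (hv : v ᵥ* hK = 0) : v = 0 :=
    Matrix.eq_zero_of_vecMul_eq_zero hdetK hv
  have hlin (a b : F) : algebraMap F K ∘ (a • A + b • B) =
      algebraMap F K a • (algebraMap F K ∘ A) + algebraMap F K b • (algebraMap F K ∘ B) := by
    funext i
    simp only [Function.comp_apply, Pi.add_apply, Pi.smul_apply, smul_eq_mul, map_add, map_mul]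
  have key (i : Fin 4) : ∃ j, ∃ c : K, P i ᵥ* hK = c • P j := by
    refine hP.complete _ (fun h0 => hP.general.ne_zero i (inj _ h0)) ?_ ?_
    · rw [← formEval_formSubst, formSubst_map, hA, hlin, formEval_add, formEval_smul,
        formEval_smul, hP.zero_left, hP.zero_right]
      simp
    · rw [← formEval_formSubst, formSubst_map, hB, hlin, formEval_add, formEval_smul,
        formEval_smul, hP.zero_left, hP.zero_right]
      simp
  choose σ c hc using key
  have hc0 (i) : c i ≠ 0 := by
    intro h0
    exact hP.general.ne_zero i (inj _ (by rw [hc, h0, zero_smul]))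
  refine ⟨σ, fun i j hij => ?_, fun i => ?_, fun i => ⟨c i, hc0 i, hc i⟩⟩
  · by_contra hne
    refine hP.general.ne_smul hne (c i * (c j)⁻¹) (sub_eq_zero.mp (inj _ ?_))
    rw [Matrix.sub_vecMul, Matrix.smul_vecMul, hc, hc, hij, smul_smul,
      mul_assoc, inv_mul_cancel₀ (hc0 j), mul_one, sub_self]
  · by_contra hne
    have h1 : P (τ i) ᵥ* hK = FiniteField.frobeniusAlgHom F K (c i) • P (τ (σ i)) := by
      rw [← hP.frobenius i, ← hP.frobenius (σ i)]
      have := congrArg (FiniteField.frobeniusAlgHom F K ∘ ·) (hc i)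
      funext j
      have := congrFun this j
      simp only [Function.comp_apply, Matrix.vecMul, dotProduct, map_sum, map_mul, hhK,
        Matrix.map_apply, AlgHom.commutes, Pi.smul_apply, smul_eq_mul] at this ⊢
      exact this
    rw [hc] at h1
    refine hP.general.ne_smul hne ((c (τ i))⁻¹ * FiniteField.frobeniusAlgHom F K (c i)) ?_
    rw [← smul_smul, ← h1, smul_smul, inv_mul_cancel₀ (hc0 _), one_smul]

lemma card_pencilStabilizer_le (hP : IsBaseLocus A B P τ) :
    (pencilStabilizer A B).card ≤ (Fintype.card F - 1) *
      (Finset.univ.filter fun σ : Fin 4 → Fin 4 =>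
        Function.Injective σ ∧ ∀ i, σ (τ i) = τ (σ i)).card := by
  choose! f f_inj f_comm hf using fun h : Matrix (Fin 3) (Fin 3) F => hP.exists_permutation (h := h)
  calc (pencilStabilizer A B).card
      ≤ (Fintype.card F - 1) * ((pencilStabilizer A B).image f).card := by
        refine Finset.card_le_mul_card_image _ _ fun p hp => ?_
        obtain ⟨h₀, hh₀, rfl⟩ := Finset.mem_image.mp hp
        have hdet : h₀.det ≠ 0 := by
          have := hh₀
          simp only [pencilStabilizer, Finset.mem_filter] at this
          exact this.2.1
        have hdetK : (h₀.map (algebraMap F K)).det ≠ 0 := by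
          rw [← RingHom.mapMatrix_apply, ← RingHom.map_det]
          simpa using hdet
        obtain ⟨i, j, hij⟩ : ∃ i j, h₀ i j ≠ 0 := by
          by_contra! h0
          exact hdet (by simp [show h₀ = 0 from Matrix.ext h0])
        have key : ∀ h ∈ pencilStabilizer A B, f h = f h₀ → ∃ d : K,
            h.map (algebraMap F K) = d • h₀.map (algebraMap F K) := by
          intro h hh e
          choose c hc0 hc using hf h hh
          choose c' hc0' hc' using hf h₀ hh₀
          refine ⟨_, hP.general.eq_smul hdetK (d := fun i => c i * (c' i)⁻¹) fun i => ?_⟩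
          rw [hc, hc', e, smul_smul, mul_assoc, inv_mul_cancel₀ (hc0' i), mul_one]
        have key' : ∀ h ∈ pencilStabilizer A B, f h = f h₀ → h = (h i j / h₀ i j) • h₀ := by
          intro h hh e
          obtain ⟨d, hd⟩ := key h hh e
          have hd' (i j) : algebraMap F K (h i j) = d * algebraMap F K (h₀ i j) := by
            simpa using congrFun (congrFun hd i) j
          have hdij : d = algebraMap F K (h i j / h₀ i j) := by
            rw [map_div₀, hd', mul_div_cancel_right₀ _ (by simpa using hij)]
          ext i' j'
          apply (algebraMap F K).injective
          rw [hd', hdij]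
          simp
        rw [← card_erase_zero]
        refine Finset.card_le_card_of_injOn (fun h => h i j) ?_ ?_
        · intro h hh
          simp only [Finset.coe_filter, Set.mem_ofPred_eq] at hh
          simp only [Finset.coe_erase, Finset.coe_univ, Set.mem_sdiff, Set.mem_univ, true_and,
            Set.mem_singleton_iff]
          intro h0
          have h1 := key' h hh.1 hh.2
          rw [h0, zero_div, zero_smul] at h1
          have := hh.1
          simp only [pencilStabilizer, Finset.mem_filter] at this
          exact this.2.1 (by simp [h1])
        · intro h hh h' hh' e
          simp only [Finset.coe_filter, Set.mem_ofPred_eq] at hh hh'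
          rw [key' h hh.1 hh.2, key' h' hh'.1 hh'.2]
          simp only at e
          rw [e]
    _ ≤ _ := by
        refine Nat.mul_le_mul_left _ (Finset.card_le_card fun σ hσ => ?_)
        obtain ⟨h, hh, rfl⟩ := Finset.mem_image.mp hσ
        simp only [Finset.mem_filter, Finset.mem_univ, true_and]
        exact ⟨f_inj h hh, f_comm h hh⟩

end IsBaseLocus

end FourPoints

section FourPointsInstances

lemma isBaseLocus_rational :
    IsBaseLocus (![0,0,1,0,-1,0] : Fin 6 → F) ![0,1,0,0,-1,0]
      (![![1,0,0], ![0,1,0], ![0,0,1], ![1,1,1]] : Fin 4 → Fin 3 → F) ![0,1,2,3] where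
  general m := by
    fin_cases m <;> simp [Matrix.det_fin_three, Fin.succAbove, Fin.lt_def]
  zero_left i := by fin_cases i <;> simp [formEval]
  zero_right i := by fin_cases i <;> simp [formEval]
  complete v hv hA hB := by
    simp [formEval] at hA hB
    have : v 0 = v 1 ∧ v 1 = v 2 ∨ v 1 = 0 ∧ v 2 = 0 ∨ v 0 = 0 ∧ v 2 = 0 ∨
      v 0 = 0 ∧ v 1 = 0 := by grind
    rcases this with h | h | h | h
    · exact ⟨3, v 0, by funext j; fin_cases j <;> simp [h]⟩
    · exact ⟨0, v 0, by funext j; fin_cases j <;> simp [h]⟩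
    · exact ⟨1, v 1, by funext j; fin_cases j <;> simp [h]⟩
    · exact ⟨2, v 2, by funext j; fin_cases j <;> simp [h]⟩
  frobenius i := by
    funext j
    fin_cases i <;> fin_cases j <;> simp [FiniteField.coe_frobeniusAlgHom]

/-- The Frobenius negates the square roots of a non-square. -/
lemma pow_card_sqrt {K : Type*} [Field K] [Algebra F K] {l : F} (hl : ¬ IsSquare l) {s : K}
    (hs : s ^ 2 = algebraMap F K l) : s ^ Fintype.card F = -s := by
  have hF : ringChar F ≠ 2 := fun h => hl (FiniteField.isSquare_of_char_two h l)
  have h1 : l ^ (Fintype.card F / 2) = -1 :=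
    (FiniteField.pow_dichotomy hF (ne_zero_of_not_isSquare hl)).resolve_left fun h =>
      hl ((FiniteField.isSquare_iff hF (ne_zero_of_not_isSquare hl)).mpr h)
  have h2 : 2 * (Fintype.card F / 2) + 1 = Fintype.card F := by
    have := FiniteField.odd_card_of_char_ne_two hF
    omega
  rw [← h2, pow_succ, pow_mul, hs, ← map_pow, h1]
  simp

lemma isBaseLocus_quadratic (h2 : (2 : F) ≠ 0) {K : Type*} [Field K] [Algebra F K] {l : F}
    (hl : ¬ IsSquare l) {s : K} (hs : s ^ 2 = algebraMap F K l) :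
    IsBaseLocus (![0,0,0,0,1,0] : Fin 6 → F) ![1,0,0,-1,0,-l]
      (![![s,0,1], ![-s,0,1], ![1,1,0], ![-1,1,0]] : Fin 4 → Fin 3 → K) ![1,0,2,3] := by
  have h2K : (2 : K) ≠ 0 := by
    rw [← map_ofNat (algebraMap F K) 2]
    simpa using h2
  have hs0 : s ≠ 0 := by
    rintro rfl
    rw [zero_pow two_ne_zero] at hs
    exact ne_zero_of_not_isSquare hl (by simpa using hs.symm)
  have hq : Odd (Fintype.card F) := Nat.odd_iff.mpr <|
    FiniteField.odd_card_of_char_ne_two fun h => hl (FiniteField.isSquare_of_char_two h l)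
  have hc := pow_card_sqrt hl hs
  refine ⟨fun m => ?_, fun i => ?_, fun i => ?_, fun v hv hA hB => ?_, fun i => ?_⟩
  · fin_cases m <;> simp [Matrix.det_fin_three, Fin.succAbove, Fin.lt_def] <;> grind
  · fin_cases i <;> simp [formEval]
  · fin_cases i <;> simp [formEval, hs]
  · simp [formEval] at hA hB
    have : v 1 = 0 ∧ v 0 = v 2 * s ∨ v 1 = 0 ∧ v 0 = -(v 2 * s) ∨ v 2 = 0 ∧ v 0 = v 1 ∨
      v 2 = 0 ∧ v 0 = -v 1 := by
      rw [← hs] at hB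
      rcases hA with h | h <;> rw [h] at hB
      · have : v 0 ^ 2 = (v 2 * s) ^ 2 := by linear_combination hB
        exact (sq_eq_sq_iff_eq_or_eq_neg.mp this).imp (⟨h, ·⟩) (.inl ⟨h, ·⟩)
      · have : v 0 ^ 2 = v 1 ^ 2 := by linear_combination hB
        exact .inr (.inr ((sq_eq_sq_iff_eq_or_eq_neg.mp this).imp (⟨h, ·⟩) (⟨h, ·⟩)))
    rcases this with h | h | h | h
    · exact ⟨0, v 2, by funext j; fin_cases j <;> simp [h]⟩
    · exact ⟨1, v 2, by funext j; fin_cases j <;> simp [h]⟩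
    · exact ⟨2, v 1, by funext j; fin_cases j <;> simp [h]⟩
    · exact ⟨3, v 1, by funext j; fin_cases j <;> simp [h]⟩
  · funext j
    fin_cases i <;> fin_cases j <;>
      simp [FiniteField.coe_frobeniusAlgHom, hc, hq.neg_pow]

lemma isBaseLocus_two_quadratic (h2 : (2 : F) ≠ 0) {K : Type*} [Field K] [Algebra F K] {l : F}
    (hl : ¬ IsSquare l) {s : K} (hs : s ^ 2 = algebraMap F K l) :
    IsBaseLocus (![0,0,0,0,1,0] : Fin 6 → F) ![1,0,0,-l,0,-l]
      (![![s,0,1], ![-s,0,1], ![s,1,0], ![-s,1,0]] : Fin 4 → Fin 3 → K) ![1,0,3,2] := by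
  have h2K : (2 : K) ≠ 0 := by
    rw [← map_ofNat (algebraMap F K) 2]
    simpa using h2
  have hs0 : s ≠ 0 := by
    rintro rfl
    rw [zero_pow two_ne_zero] at hs
    exact ne_zero_of_not_isSquare hl (by simpa using hs.symm)
  have hq : Odd (Fintype.card F) := Nat.odd_iff.mpr <|
    FiniteField.odd_card_of_char_ne_two fun h => hl (FiniteField.isSquare_of_char_two h l)
  have hc := pow_card_sqrt hl hs
  refine ⟨fun m => ?_, fun i => ?_, fun i => ?_, fun v hv hA hB => ?_, fun i => ?_⟩
  · fin_cases m <;> simp [Matrix.det_fin_three, Fin.succAbove, Fin.lt_def] <;> grind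
  · fin_cases i <;> simp [formEval]
  · fin_cases i <;> simp [formEval, hs]
  · simp [formEval] at hA hB
    have : v 1 = 0 ∧ v 0 = v 2 * s ∨ v 1 = 0 ∧ v 0 = -(v 2 * s) ∨ v 2 = 0 ∧ v 0 = v 1 * s ∨
      v 2 = 0 ∧ v 0 = -(v 1 * s) := by
      rw [← hs] at hB
      rcases hA with h | h <;> rw [h] at hB
      · have : v 0 ^ 2 = (v 2 * s) ^ 2 := by linear_combination hB
        exact (sq_eq_sq_iff_eq_or_eq_neg.mp this).imp (⟨h, ·⟩) (.inl ⟨h, ·⟩)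
      · have : v 0 ^ 2 = (v 1 * s) ^ 2 := by linear_combination hB
        exact .inr (.inr ((sq_eq_sq_iff_eq_or_eq_neg.mp this).imp (⟨h, ·⟩) (⟨h, ·⟩)))
    rcases this with h | h | h | h
    · exact ⟨0, v 2, by funext j; fin_cases j <;> simp [h]⟩
    · exact ⟨1, v 2, by funext j; fin_cases j <;> simp [h]⟩
    · exact ⟨2, v 1, by funext j; fin_cases j <;> simp [h]⟩
    · exact ⟨3, v 1, by funext j; fin_cases j <;> simp [h]⟩
  · funext j
    fin_cases i <;> fin_cases j <;>
      simp [FiniteField.coe_frobeniusAlgHom, hc, hq.neg_pow]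

section Irreducible

open FiniteField

variable {f : Polynomial F}

lemma finrank_adjoinRoot (hf : f.Monic) : Module.finrank F (AdjoinRoot f) = f.natDegree := by
  simpa using (AdjoinRoot.powerBasis' hf).finrank

variable [Fact (Irreducible f)]

lemma finite_adjoinRoot (hf : f.Monic) : Finite (AdjoinRoot f) := by
  have := (AdjoinRoot.powerBasis' hf).finite
  exact Module.finite_of_finite F

lemma frobenius_root_injective (hf : f.Monic) {i j : ℕ} (hi : i < f.natDegree)
    (hj : j < f.natDegree)
    (h : ((frobeniusAlgHom F (AdjoinRoot f)) ^ i) (AdjoinRoot.root f) =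
      ((frobeniusAlgHom F (AdjoinRoot f)) ^ j) (AdjoinRoot.root f)) : i = j := by
  have := finite_adjoinRoot hf
  have hn := finrank_adjoinRoot hf
  have := (bijective_frobeniusAlgHom_pow F (AdjoinRoot f)).1 (a₁ := ⟨i, hn ▸ hi⟩)
    (a₂ := ⟨j, hn ▸ hj⟩) (AdjoinRoot.algHom_ext h)
  simpa using this

lemma exists_eq_frobenius_root (hf : f.Monic) {x : AdjoinRoot f} (hx : Polynomial.aeval x f = 0) :
    ∃ i < f.natDegree, x = ((frobeniusAlgHom F (AdjoinRoot f)) ^ i) (AdjoinRoot.root f) := by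
  have := finite_adjoinRoot hf
  obtain ⟨n, hn⟩ := (bijective_frobeniusAlgHom_pow F (AdjoinRoot f)).2
    (AdjoinRoot.liftAlgHom f (Algebra.ofId F (AdjoinRoot f)) x hx)
  refine ⟨n, n.2.trans_eq (finrank_adjoinRoot hf), ?_⟩
  simp only at hn
  rw [hn]
  exact (AdjoinRoot.liftAlgHom_root _ _ _ _).symm

lemma frobenius_pow_natDegree (hf : f.Monic) :
    (frobeniusAlgHom F (AdjoinRoot f)) ^ f.natDegree = 1 := by
  have := finite_adjoinRoot hf
  rw [← finrank_adjoinRoot hf, ← orderOf_frobeniusAlgHom F (AdjoinRoot f)]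
  exact pow_orderOf_eq_one _

/-- The point of the conic `uw = v²` with parameter `x`. -/
def conicPoint {R : Type*} [CommRing R] (x : R) : Fin 3 → R := ![x ^ 2, x, 1]

lemma eq_smul_conicPoint {K : Type*} [Field K] {v : Fin 3 → K} (hv : v 0 * v 2 = v 1 ^ 2)
    (h2 : v 2 ≠ 0) : v = v 2 • conicPoint (v 1 / v 2) := by
  funext j
  fin_cases j <;> simp [conicPoint] <;> field_simp
  exact hv

lemma comp_conicPoint {K : Type*} [Field K] [Algebra F K] (φ : K →ₐ[F] K) (x : K) :
    φ ∘ conicPoint x = conicPoint (φ x) := by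
  funext j
  fin_cases j <;> simp [conicPoint]

lemma isBaseLocus_cubic (hf : f.Monic) (hn : f.natDegree = 3) {a b c : F}
    (hx : ∀ x : AdjoinRoot f, Polynomial.aeval x f =
      x ^ 3 + algebraMap F _ a * x ^ 2 + algebraMap F _ b * x + algebraMap F _ c) :
    ∃ P : Fin 4 → Fin 3 → AdjoinRoot f,
      IsBaseLocus (![0,0,1,-1,0,0] : Fin 6 → F) ![0,1,0,a,b,c] P ![0,2,3,1] := by
  set t : ℕ → AdjoinRoot f :=
    fun i => ((frobeniusAlgHom F (AdjoinRoot f)) ^ i) (AdjoinRoot.root f) with ht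
  have hinj {i j : ℕ} (hi : i < 3) (hj : j < 3) (h : i ≠ j) : t i - t j ≠ 0 := fun h' =>
    h (frobenius_root_injective hf (by omega) (by omega) (sub_eq_zero.mp h'))
  have hroot (i : ℕ) : t i ^ 3 + algebraMap F _ a * t i ^ 2 + algebraMap F _ b * t i +
      algebraMap F _ c = 0 := by
    rw [← hx, ht]
    simp only [Polynomial.aeval_algHom_apply]
    simp
  have hsucc (i : ℕ) : frobeniusAlgHom F (AdjoinRoot f) (t i) = t (i + 1) := by
    simp only [ht, pow_succ', AlgHom.mul_apply]
  have h3 : t 3 = t 0 := by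
    simp only [ht, ← hn, frobenius_pow_natDegree hf, pow_zero]
  have h01 := hinj (i := 0) (j := 1) (by omega) (by omega) (by omega)
  have h02 := hinj (i := 0) (j := 2) (by omega) (by omega) (by omega)
  have h12 := hinj (i := 1) (j := 2) (by omega) (by omega) (by omega)
  have hc (x : AdjoinRoot f) : frobeniusAlgHom F (AdjoinRoot f) ∘ conicPoint x =
    conicPoint (frobeniusAlgHom F (AdjoinRoot f) x) := comp_conicPoint _ x
  refine ⟨![![1, 0, 0], conicPoint (t 0), conicPoint (t 1), conicPoint (t 2)],
    fun m => ?_, fun i => ?_, fun i => ?_, fun v hv hA hB => ?_, fun i => ?_⟩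
  · have : (t 0 - t 1) * (t 0 - t 2) * (t 1 - t 2) ≠ 0 :=
      mul_ne_zero (mul_ne_zero h01 h02) h12
    fin_cases m <;> simp [Matrix.det_fin_three, Fin.succAbove, Fin.lt_def, conicPoint]
    · convert this using 1; ring
    all_goals assumption
  · fin_cases i <;> simp [formEval, conicPoint]
  · have (x : AdjoinRoot f) : formEval (algebraMap F (AdjoinRoot f) ∘ ![0,1,0,a,b,c])
      (conicPoint x) = x ^ 3 + algebraMap F _ a * x ^ 2 + algebraMap F _ b * x +
        algebraMap F _ c := by
      simp [formEval, conicPoint, -AdjoinRoot.algebraMap_eq]; ring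
    fin_cases i
    · simp [formEval]
    all_goals simp [this, hroot, -AdjoinRoot.algebraMap_eq]
  · simp [formEval, -AdjoinRoot.algebraMap_eq] at hA hB
    by_cases hv2 : v 2 = 0
    · refine ⟨0, v 0, ?_⟩
      have : v 1 = 0 := by simpa [hv2] using hA
      funext j; fin_cases j <;> simp [hv2, this]
    · have hv' := eq_smul_conicPoint (by linear_combination hA) hv2
      obtain ⟨i, hi, h⟩ := exists_eq_frobenius_root hf (x := v 1 / v 2) (by
        rw [hx]; field_simp; linear_combination hB * v 2 - v 1 * hA)
      rw [hn] at hi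
      rw [h] at hv'
      interval_cases i
      · exact ⟨1, v 2, hv'⟩
      · exact ⟨2, v 2, hv'⟩
      · exact ⟨3, v 2, hv'⟩
  · fin_cases i
    · funext j; fin_cases j <;> simp
    · simp [hc, hsucc]
    · simp [hc, hsucc]
    · simp [hc, hsucc, h3]

lemma isBaseLocus_quartic (hf : f.Monic) (hn : f.natDegree = 4) {a b c d : F}
    (hx : ∀ x : AdjoinRoot f, Polynomial.aeval x f = x ^ 4 + algebraMap F _ a * x ^ 3 +
      algebraMap F _ b * x ^ 2 + algebraMap F _ c * x + algebraMap F _ d) :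
    ∃ P : Fin 4 → Fin 3 → AdjoinRoot f,
      IsBaseLocus (![0,0,1,-1,0,0] : Fin 6 → F) ![1,a,0,b,c,d] P ![1,2,3,0] := by
  set t : ℕ → AdjoinRoot f :=
    fun i => ((frobeniusAlgHom F (AdjoinRoot f)) ^ i) (AdjoinRoot.root f) with ht
  have hinj {i j : ℕ} (hi : i < 4) (hj : j < 4) (h : i ≠ j) : t i - t j ≠ 0 := fun h' =>
    h (frobenius_root_injective hf (by omega) (by omega) (sub_eq_zero.mp h'))
  have hroot (i : ℕ) : t i ^ 4 + algebraMap F _ a * t i ^ 3 + algebraMap F _ b * t i ^ 2 +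
      algebraMap F _ c * t i + algebraMap F _ d = 0 := by
    rw [← hx, ht]
    simp only [Polynomial.aeval_algHom_apply]
    simp
  have hsucc (i : ℕ) : frobeniusAlgHom F (AdjoinRoot f) (t i) = t (i + 1) := by
    simp only [ht, pow_succ', AlgHom.mul_apply]
  have h4 : t 4 = t 0 := by
    simp only [ht, ← hn, frobenius_pow_natDegree hf, pow_zero]
  have hc (x : AdjoinRoot f) : frobeniusAlgHom F (AdjoinRoot f) ∘ conicPoint x =
    conicPoint (frobeniusAlgHom F (AdjoinRoot f) x) := comp_conicPoint _ x
  have hdet {i j k : ℕ} (hi : i < j) (hj : j < k) (hk : k < 4) :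
      (t i - t j) * (t i - t k) * (t j - t k) ≠ 0 :=
    mul_ne_zero (mul_ne_zero (hinj (by omega) (by omega) (by omega))
      (hinj (by omega) (by omega) (by omega))) (hinj (by omega) (by omega) (by omega))
  refine ⟨![conicPoint (t 0), conicPoint (t 1), conicPoint (t 2), conicPoint (t 3)],
    fun m => ?_, fun i => ?_, fun i => ?_, fun v hv hA hB => ?_, fun i => ?_⟩
  · fin_cases m <;> simp [Matrix.det_fin_three, Fin.succAbove, Fin.lt_def, conicPoint]
    · convert hdet (i := 1) (j := 2) (k := 3) (by omega) (by omega) (by omega) using 1; ring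
    · convert hdet (i := 0) (j := 2) (k := 3) (by omega) (by omega) (by omega) using 1; ring
    · convert hdet (i := 0) (j := 1) (k := 3) (by omega) (by omega) (by omega) using 1; ring
    · convert hdet (i := 0) (j := 1) (k := 2) (by omega) (by omega) (by omega) using 1; ring
  · fin_cases i <;> simp [formEval, conicPoint]
  · have (x : AdjoinRoot f) : formEval (algebraMap F (AdjoinRoot f) ∘ ![1,a,0,b,c,d])
      (conicPoint x) = x ^ 4 + algebraMap F _ a * x ^ 3 + algebraMap F _ b * x ^ 2 +
        algebraMap F _ c * x + algebraMap F _ d := by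
      simp [formEval, conicPoint, -AdjoinRoot.algebraMap_eq]; ring
    fin_cases i <;> simp [this, hroot, -AdjoinRoot.algebraMap_eq]
  · simp [formEval, -AdjoinRoot.algebraMap_eq] at hA hB
    by_cases hv2 : v 2 = 0
    · have h1 : v 1 = 0 := by simpa [hv2] using hA
      have h0 : v 0 = 0 := by simpa [hv2, h1] using hB
      exact absurd (_root_.funext fun j => by fin_cases j <;> simp [h0, h1, hv2]) hv
    · have hv' := eq_smul_conicPoint (by linear_combination hA) hv2
      obtain ⟨i, hi, h⟩ := exists_eq_frobenius_root hf (x := v 1 / v 2) (by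
        rw [hx]; field_simp
        linear_combination hB * v 2 ^ 2 - (v 0 * v 2 + v 1 ^ 2 + algebraMap F _ a * v 1 * v 2) * hA)
      rw [hn] at hi
      rw [h] at hv'
      interval_cases i
      · exact ⟨0, v 2, hv'⟩
      · exact ⟨1, v 2, hv'⟩
      · exact ⟨2, v 2, hv'⟩
      · exact ⟨3, v 2, hv'⟩
  · fin_cases i
    · simp [hc, hsucc]
    · simp [hc, hsucc]
    · simp [hc, hsucc]
    · simp [hc, hsucc, h4]

end Irreducible

end FourPointsInstances

lemma card_pencilStabilizer_le_of_isBaseLocus {K : Type*} [Field K] [Algebra F K]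
    {A B : Fin 6 → F} {P : Fin 4 → Fin 3 → K} {τ : Fin 4 → Fin 4} (hP : IsBaseLocus A B P τ)
    {n : ℕ} (hτ : (Finset.univ.filter fun σ : Fin 4 → Fin 4 =>
        Function.Injective σ ∧ ∀ i, σ (τ i) = τ (σ i)).card = n) :
    (pencilStabilizer A B).card ≤ (Fintype.card F - 1) * n := by
  have := hP.card_pencilStabilizer_le
  rw [← hτ]
  convert this

lemma card_pencilStabilizer_rational :
    (pencilStabilizer (![0,0,1,0,-1,0] : Fin 6 → F) ![0,1,0,0,-1,0]).card ≤
      (Fintype.card F - 1) * 24 :=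
  card_pencilStabilizer_le_of_isBaseLocus isBaseLocus_rational (by decide +kernel)

lemma card_pencilStabilizer_quadratic (h2 : (2 : F) ≠ 0) (l : F) (hl : ¬ IsSquare l) :
    (pencilStabilizer (![0,0,0,0,1,0] : Fin 6 → F) ![1,0,0,-1,0,-l]).card ≤
      (Fintype.card F - 1) * 4 := by
  obtain ⟨s, hs⟩ := IsAlgClosed.exists_pow_nat_eq (algebraMap F (AlgebraicClosure F) l) two_pos
  exact card_pencilStabilizer_le_of_isBaseLocus (isBaseLocus_quadratic h2 hl hs)
    (by decide +kernel)

lemma card_pencilStabilizer_two_quadratic (h2 : (2 : F) ≠ 0) (l : F) (hl : ¬ IsSquare l) :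
    (pencilStabilizer (![0,0,0,0,1,0] : Fin 6 → F) ![1,0,0,-l,0,-l]).card ≤
      (Fintype.card F - 1) * 8 := by
  obtain ⟨s, hs⟩ := IsAlgClosed.exists_pow_nat_eq (algebraMap F (AlgebraicClosure F) l) two_pos
  exact card_pencilStabilizer_le_of_isBaseLocus (isBaseLocus_two_quadratic h2 hl hs)
    (by decide +kernel)

lemma card_pencilStabilizer_cubic {a b c : F}
    (h : Irreducible (Polynomial.X ^ 3 + Polynomial.C a * Polynomial.X ^ 2 +
      Polynomial.C b * Polynomial.X + Polynomial.C c : Polynomial F)) :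
    (pencilStabilizer (![0,0,1,-1,0,0] : Fin 6 → F) ![0,1,0,a,b,c]).card ≤
      (Fintype.card F - 1) * 3 := by
  have := Fact.mk h
  obtain ⟨P, hP⟩ := isBaseLocus_cubic (f := Polynomial.X ^ 3 + Polynomial.C a * Polynomial.X ^ 2 +
      Polynomial.C b * Polynomial.X + Polynomial.C c)
    (a := a) (b := b) (c := c) (by monicity!) (by compute_degree!) (fun x => by simp)
  exact card_pencilStabilizer_le_of_isBaseLocus hP (by decide +kernel)

lemma card_pencilStabilizer_quartic {a b c d : F}
    (h : Irreducible (Polynomial.X ^ 4 + Polynomial.C a * Polynomial.X ^ 3 +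
      Polynomial.C b * Polynomial.X ^ 2 + Polynomial.C c * Polynomial.X +
      Polynomial.C d : Polynomial F)) :
    (pencilStabilizer (![0,0,1,-1,0,0] : Fin 6 → F) ![1,a,0,b,c,d]).card ≤
      (Fintype.card F - 1) * 4 := by
  have := Fact.mk h
  obtain ⟨P, hP⟩ := isBaseLocus_quartic (f := Polynomial.X ^ 4 + Polynomial.C a * Polynomial.X ^ 3 +
      Polynomial.C b * Polynomial.X ^ 2 + Polynomial.C c * Polynomial.X + Polynomial.C d)
    (a := a) (b := b) (c := c) (d := d) (by monicity!) (by compute_degree!) (fun x => by simp)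
  exact card_pencilStabilizer_le_of_isBaseLocus hP (by decide +kernel)

section CommonZeros

/-- `P` lists the common zeros of `A` and `B` in the projective plane. -/
structure IsZeroSystem {ι : Type*} (A B : Fin 6 → F) (P : ι → Fin 3 → F) : Prop where
  ne_zero : ∀ i, P i ≠ 0
  eq_of_smul : ∀ i j, ∀ c : F, P i = c • P j → i = j
  zero_left : ∀ i, formEval A (P i) = 0
  zero_right : ∀ i, formEval B (P i) = 0
  complete : ∀ v ≠ 0, formEval A v = 0 → formEval B v = 0 → ∃ i, ∃ c : F, v = c • P i

lemma formEval_rep_mk (A : Fin 6 → F) {v : Fin 3 → F} (hv : v ≠ 0) :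
    formEval A (Projectivization.mk F v hv).rep = 0 ↔ formEval A v = 0 := by
  obtain ⟨a, ha⟩ := Projectivization.exists_smul_eq_mk_rep F v hv
  rw [← ha, Units.smul_def, formEval_vec_smul]
  simp

lemma IsZeroSystem.commonZerosPT_eq {ι : Type*} {A B : Fin 6 → F} {P : ι → Fin 3 → F}
    (h : IsZeroSystem A B P) : commonZerosPT (A, B) = Nat.card ι := by
  have hz (i : ι) : MvPolynomial.eval (Projectivization.mk F (P i) (h.ne_zero i)).rep (TQ A) = 0 ∧
      MvPolynomial.eval (Projectivization.mk F (P i) (h.ne_zero i)).rep (TQ B) = 0 := by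
    simp only [eval_TQ, formEval_rep_mk, h.zero_left, h.zero_right, and_self]
  refine (Nat.card_congr (Equiv.ofBijective
    (fun i => ⟨Projectivization.mk F (P i) (h.ne_zero i), hz i⟩)
    ⟨fun i j hij => ?_, fun x => ?_⟩)).symm
  · obtain ⟨a, ha⟩ := (Projectivization.mk_eq_mk_iff' F _ _ _ _).mp (congrArg Subtype.val hij)
    exact h.eq_of_smul i j a ha.symm
  · obtain ⟨x, hx⟩ := x
    simp only [eval_TQ] at hx
    obtain ⟨i, c, hc⟩ := h.complete x.rep x.rep_nonzero hx.1 hx.2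
    refine ⟨i, Subtype.ext (Eq.trans ?_ x.mk_rep)⟩
    refine (Projectivization.mk_eq_mk_iff' F _ _ _ _).mpr ⟨c⁻¹, ?_⟩
    have : c ≠ 0 := by
      rintro rfl
      exact x.rep_nonzero (by rw [hc, zero_smul])
    rw [hc, inv_smul_smul₀ this]

lemma isZeroSystem_rep (A B : Fin 6 → F) : IsZeroSystem A B
    (fun x : {x : Projectivization F (Fin 3 → F) //
      formEval A x.rep = 0 ∧ formEval B x.rep = 0} => x.1.rep) where
  ne_zero x := x.1.rep_nonzero
  eq_of_smul x y c h := by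
    refine Subtype.ext ?_
    rw [← x.1.mk_rep, ← y.1.mk_rep]
    exact (Projectivization.mk_eq_mk_iff' F _ _ _ _).mpr ⟨c, h.symm⟩
  zero_left x := x.2.1
  zero_right x := x.2.2
  complete v hv hA hB := by
    obtain ⟨a, ha⟩ := Projectivization.exists_smul_eq_mk_rep F v hv
    refine ⟨⟨Projectivization.mk F v hv, ?_⟩, (a⁻¹ : Fˣ), ?_⟩
    · simp only [formEval_rep_mk, hA, hB, and_self]
    · rw [← Units.smul_def, ← ha, inv_smul_smul]

lemma IsZeroSystem.smul {ι : Type*} {x : FormPair F} {P : ι → Fin 3 → F}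
    (h : IsZeroSystem x.fst x.snd P) (g : GL (Fin 2) F × GL (Fin 3) F) :
    IsZeroSystem (g • x).fst (g • x).snd
      (fun i => P i ᵥ* ((g.2⁻¹ : GL (Fin 3) F) : Matrix (Fin 3) (Fin 3) F)) := by
  have hg (v : Fin 3 → F) : v ᵥ* (g.2 : Matrix (Fin 3) (Fin 3) F) ᵥ*
      ((g.2⁻¹ : GL (Fin 3) F) : Matrix (Fin 3) (Fin 3) F) = v := by
    rw [Matrix.vecMul_vecMul, ← Units.val_mul, mul_inv_cancel, Units.val_one, Matrix.vecMul_one]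
  have hg' (v : Fin 3 → F) : v ᵥ* ((g.2⁻¹ : GL (Fin 3) F) : Matrix (Fin 3) (Fin 3) F) ᵥ*
      (g.2 : Matrix (Fin 3) (Fin 3) F) = v := by
    rw [Matrix.vecMul_vecMul, ← Units.val_mul, inv_mul_cancel, Units.val_one, Matrix.vecMul_one]
  refine ⟨fun i hi => h.ne_zero i ?_, fun i j c hij => h.eq_of_smul i j c ?_, fun i => ?_,
    fun i => ?_, fun v hv hA hB => ?_⟩
  · rw [← hg' (P i), hi, Matrix.zero_vecMul]
  · rw [← hg' (P i), hij, Matrix.smul_vecMul, hg']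
  · simp [FormPair.smul_fst, formEval_add, formEval_smul, formEval_formSubst, h.zero_left,
      h.zero_right]
  · simp [FormPair.smul_snd, formEval_add, formEval_smul, formEval_formSubst, h.zero_left,
      h.zero_right]
  · simp only [FormPair.smul_fst, FormPair.smul_snd, formEval_add, formEval_smul,
      formEval_formSubst] at hA hB
    have hd : g.1 0 0 * g.1 1 1 - g.1 0 1 * g.1 1 0 ≠ 0 := by
      rw [← Matrix.det_fin_two]
      exact (Matrix.isUnit_iff_isUnit_det _).mp g.1.isUnit |>.ne_zero
    obtain ⟨i, c, hc⟩ := h.complete (v ᵥ* (g.2 : Matrix (Fin 3) (Fin 3) F))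
      (fun h0 => hv (by rw [← hg v, h0, Matrix.zero_vecMul]))
      (mul_left_cancel₀ hd (by linear_combination g.1 1 1 * hA - g.1 0 1 * hB))
      (mul_left_cancel₀ hd (by linear_combination g.1 0 0 * hB - g.1 1 0 * hA))
    exact ⟨i, c, by rw [← Matrix.smul_vecMul, ← hc, hg]⟩

lemma commonZerosPT_smul (g : GL (Fin 2) F × GL (Fin 3) F) (x : FormPair F) :
    commonZerosPT ((g • x).fst, (g • x).snd) = commonZerosPT (x.fst, x.snd) := by
  rw [((isZeroSystem_rep _ _).smul g).commonZerosPT_eq, (isZeroSystem_rep _ _).commonZerosPT_eq]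

end CommonZeros

section ZeroCounts

lemma commonZerosPT_zero : commonZerosPT ((0, 0) : (Fin 6 → F) × (Fin 6 → F)) =
    Fintype.card F ^ 2 + Fintype.card F + 1 := by
  have : IsZeroSystem (0 : Fin 6 → F) 0
      (Sum.elim (fun x : F × F => ![x.1, x.2, 1]) fun x : Option F =>
        x.elim ![1, 0, 0] fun t => ![t, 1, 0]) := by
    refine ⟨?_, ?_, ?_, ?_, fun v hv _ _ => ?_⟩
    · rintro (x | _ | t) <;> simp
    · rintro (x | _ | t) (y | _ | u) c <;>
        simp +contextual [funext_iff, Fin.forall_fin_succ, Prod.ext_iff, eq_comm] <;>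
        grind
    · simp [formEval]
    · simp [formEval]
    · by_cases h2 : v 2 = 0
      · by_cases h1 : v 1 = 0
        · exact ⟨.inr none, v 0, by ext j; fin_cases j <;> simp [h1, h2]⟩
        · exact ⟨.inr (some (v 0 / v 1)), v 1, by ext j; fin_cases j <;> simp [h2]; field_simp⟩
      · exact ⟨.inl (v 0 / v 2, v 1 / v 2), v 2, by ext j; fin_cases j <;> simp <;> field_simp⟩
  rw [this.commonZerosPT_eq]
  simp
  ring

lemma commonZerosPT_line {A B : Fin 6 → F}
    (h : ∀ v, formEval A v = 0 ∧ formEval B v = 0 ↔ v 2 = 0) :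
    commonZerosPT (A, B) = Fintype.card F + 1 := by
  have : IsZeroSystem A B (fun x : Option F => x.elim ![1, 0, 0] fun t => ![t, 1, 0]) := by
    refine ⟨?_, ?_, fun x => ((h _).mpr ?_).1, fun x => ((h _).mpr ?_).2, fun v hv hA hB => ?_⟩
    · rintro (_ | t) <;> simp
    · rintro (_ | t) (_ | u) c <;> simp +contextual [funext_iff, Fin.forall_fin_succ, eq_comm] <;>
        grind
    · cases x <;> simp
    · cases x <;> simp
    · have h2 := (h v).mp ⟨hA, hB⟩
      by_cases h1 : v 1 = 0
      · exact ⟨none, v 0, by ext j; fin_cases j <;> simp [h1, h2]⟩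
      · exact ⟨some (v 0 / v 1), v 1, by ext j; fin_cases j <;> simp [h2]; field_simp⟩
  rw [this.commonZerosPT_eq]
  simp

lemma commonZerosPT_two_lines :
    commonZerosPT ((0, ![0,0,0,0,1,0]) : (Fin 6 → F) × (Fin 6 → F)) =
      2 * Fintype.card F + 1 := by
  have : IsZeroSystem (0 : Fin 6 → F) ![0,0,0,0,1,0] (fun x : Option (F ⊕ F) =>
      x.elim ![1, 0, 0] (Sum.elim (fun t => ![t, 1, 0]) fun t => ![t, 0, 1])) := by
    refine ⟨?_, ?_, ?_, ?_, fun v hv _ hB => ?_⟩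
    · rintro (_ | t | t) <;> simp
    · rintro (_ | t | t) (_ | u | u) c <;>
        simp +contextual [funext_iff, Fin.forall_fin_succ, eq_comm] <;>
        grind
    · simp [formEval]
    · rintro (_ | t | t) <;> simp [formEval]
    · have hB : v 1 * v 2 = 0 := by simpa [formEval] using hB
      by_cases h2 : v 2 = 0
      · by_cases h1 : v 1 = 0
        · exact ⟨none, v 0, by ext j; fin_cases j <;> simp [h1, h2]⟩
        · exact ⟨some (.inl (v 0 / v 1)), v 1, by ext j; fin_cases j <;> simp [h2]; field_simp⟩
      · have h1 : v 1 = 0 := by simpa [h2] using hB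
        exact ⟨some (.inr (v 0 / v 2)), v 2, by ext j; fin_cases j <;> simp [h1]; field_simp⟩
  rw [this.commonZerosPT_eq]
  simp
  ring

lemma commonZerosPT_conic :
    commonZerosPT ((0, ![1,0,0,0,-1,0]) : (Fin 6 → F) × (Fin 6 → F)) = Fintype.card F + 1 := by
  have : IsZeroSystem (0 : Fin 6 → F) ![1,0,0,0,-1,0]
      (fun x : Option F => x.elim ![0, 1, 0] fun t => ![t, t ^ 2, 1]) := by
    refine ⟨?_, ?_, ?_, ?_, fun v hv _ hB => ?_⟩
    · rintro (_ | t) <;> simp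
    · rintro (_ | t) (_ | u) c <;> simp +contextual [funext_iff, Fin.forall_fin_succ, eq_comm] <;>
        grind
    · simp [formEval]
    · rintro (_ | t) <;> simp [formEval]
    · have hB : v 0 ^ 2 = v 1 * v 2 := by
        simp [formEval] at hB
        linear_combination hB
      by_cases h2 : v 2 = 0
      · have h0 : v 0 = 0 := by simpa [h2] using hB
        exact ⟨none, v 1, by ext j; fin_cases j <;> simp [h0, h2]⟩
      · refine ⟨some (v 0 / v 2), v 2, ?_⟩
        ext j; fin_cases j <;> simp <;> field_simp
        exact hB.symm
  rw [this.commonZerosPT_eq]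
  simp

lemma commonZerosPT_line_and_point :
    commonZerosPT ((![0,0,0,0,1,0], ![0,0,1,0,0,0]) : (Fin 6 → F) × (Fin 6 → F)) =
      Fintype.card F + 2 := by
  have : IsZeroSystem (![0,0,0,0,1,0] : Fin 6 → F) ![0,0,1,0,0,0] (fun x : Option (Option F) =>
      x.elim ![0, 0, 1] fun x => x.elim ![1, 0, 0] fun t => ![t, 1, 0]) := by
    refine ⟨?_, ?_, ?_, ?_, fun v hv hA hB => ?_⟩
    · rintro (_ | _ | t) <;> simp
    · rintro (_ | _ | t) (_ | _ | u) c <;>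
        simp +contextual [funext_iff, Fin.forall_fin_succ, eq_comm] <;>
        grind
    · rintro (_ | _ | t) <;> simp [formEval]
    · rintro (_ | _ | t) <;> simp [formEval]
    · simp [formEval] at hA hB
      by_cases h2 : v 2 = 0
      · by_cases h1 : v 1 = 0
        · exact ⟨some none, v 0, by ext j; fin_cases j <;> simp [h1, h2]⟩
        · exact ⟨some (some (v 0 / v 1)), v 1, by
            ext j; fin_cases j <;> simp [h2]; field_simp⟩
      · have h1 : v 1 = 0 := by simpa [h2] using hA
        have h0 : v 0 = 0 := by simpa [h2] using hB
        exact ⟨none, v 2, by ext j; fin_cases j <;> simp [h0, h1]⟩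
  rw [this.commonZerosPT_eq]
  simp

lemma commonZerosPT_eq_one {A B : Fin 6 → F}
    (h : ∀ v, formEval A v = 0 ∧ formEval B v = 0 ↔ v 1 = 0 ∧ v 2 = 0) :
    commonZerosPT (A, B) = 1 := by
  have : IsZeroSystem A B (fun _ : Unit => ![1, 0, 0]) := by
    refine ⟨?_, ?_, fun x => ((h _).mpr ?_).1, fun x => ((h _).mpr ?_).2, fun v hv hA hB => ?_⟩
    · simp
    · simp
    · simp
    · simp
    · obtain ⟨h1, h2⟩ := (h v).mp ⟨hA, hB⟩
      exact ⟨(), v 0, by ext j; fin_cases j <;> simp [h1, h2]⟩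
  rw [this.commonZerosPT_eq]
  simp

lemma commonZerosPT_eq_zero {A B : Fin 6 → F}
    (h : ∀ v, formEval A v = 0 → formEval B v = 0 → v = 0) :
    commonZerosPT (A, B) = 0 := by
  have : IsZeroSystem A B (fun x : Empty => x.elim) :=
    ⟨nofun, nofun, nofun, nofun, fun v hv hA hB => (hv (h v hA hB)).elim⟩
  rw [this.commonZerosPT_eq]
  simp

lemma commonZerosPT_mul_conic :
    commonZerosPT ((![0,0,0,0,1,0], ![0,0,1,1,0,0]) : (Fin 6 → F) × (Fin 6 → F)) = 2 := by
  have : IsZeroSystem (![0,0,0,0,1,0] : Fin 6 → F) ![0,0,1,1,0,0] ![![1, 0, 0], ![0, 0, 1]] := by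
    refine ⟨?_, ?_, ?_, ?_, fun v hv hA hB => ?_⟩
    · simp [Fin.forall_fin_succ]
    · simp [Fin.forall_fin_succ]
    · simp [Fin.forall_fin_succ, formEval]
    · simp [Fin.forall_fin_succ, formEval]
    · simp [formEval] at hA hB
      have : v 1 = 0 ∧ (v 0 = 0 ∨ v 2 = 0) := by grind
      obtain ⟨h1, h | h⟩ := this
      · exact ⟨1, v 2, by ext j; fin_cases j <;> simp [h1, h]⟩
      · exact ⟨0, v 0, by ext j; fin_cases j <;> simp [h1, h]⟩
  simp [this.commonZerosPT_eq]

lemma commonZerosPT_split (h2 : (2 : F) ≠ 0) {A B : Fin 6 → F}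
    (h : ∀ v, formEval A v = 0 ∧ formEval B v = 0 ↔ v 2 = 0 ∧ v 0 ^ 2 = v 1 ^ 2) :
    commonZerosPT (A, B) = 2 := by
  have : IsZeroSystem A B ![![1, 1, 0], ![-1, 1, 0]] := by
    refine ⟨?_, ?_, fun i => ((h _).mpr ?_).1, fun i => ((h _).mpr ?_).2, fun v hv hA hB => ?_⟩
    · simp [Fin.forall_fin_succ]
    · simp [Fin.forall_fin_succ, funext_iff]
      grind
    · fin_cases i <;> simp
    · fin_cases i <;> simp
    · obtain ⟨h3, h⟩ := (h v).mp ⟨hA, hB⟩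
      obtain h | h := sq_eq_sq_iff_eq_or_eq_neg.mp h
      · exact ⟨0, v 1, by ext j; fin_cases j <;> simp [h3, h]⟩
      · exact ⟨1, v 1, by ext j; fin_cases j <;> simp [h3, h]⟩
  simp [this.commonZerosPT_eq]

lemma commonZerosPT_split_mul (h2 : (2 : F) ≠ 0) :
    commonZerosPT ((![0,0,0,1,0,-1], ![0,0,1,0,0,0]) : (Fin 6 → F) × (Fin 6 → F)) = 3 := by
  have : IsZeroSystem (![0,0,0,1,0,-1] : Fin 6 → F) ![0,0,1,0,0,0]
      ![![1, 0, 0], ![0, 1, 1], ![0, -1, 1]] := by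
    refine ⟨?_, ?_, ?_, ?_, fun v hv hA hB => ?_⟩
    · simp [Fin.forall_fin_succ]
    · simp [Fin.forall_fin_succ, funext_iff]
      grind
    · simp [Fin.forall_fin_succ, formEval]
    · simp [Fin.forall_fin_succ, formEval]
    · simp [formEval] at hA hB
      have : v 1 = v 2 ∨ v 1 = -v 2 := sq_eq_sq_iff_eq_or_eq_neg.mp (by linear_combination hA)
      by_cases h3 : v 2 = 0
      · exact ⟨0, v 0, by ext j; fin_cases j <;> simp; all_goals grind⟩
      · have h0 : v 0 = 0 := by simpa [h3] using hB
        obtain h | h := this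
        · exact ⟨1, v 2, by ext j; fin_cases j <;> simp [h0, h]⟩
        · exact ⟨2, v 2, by ext j; fin_cases j <;> simp [h0, h]⟩
  simp [this.commonZerosPT_eq]

lemma commonZerosPT_rational :
    commonZerosPT ((![0,0,1,0,-1,0], ![0,1,0,0,-1,0]) : (Fin 6 → F) × (Fin 6 → F)) = 4 := by
  have h := isBaseLocus_rational (F := F)
  have : IsZeroSystem (![0,0,1,0,-1,0] : Fin 6 → F) ![0,1,0,0,-1,0]
      ![![1,0,0], ![0,1,0], ![0,0,1], ![1,1,1]] :=
    ⟨h.general.ne_zero, fun i j c hij => by_contra fun hne => h.general.ne_smul hne c hij,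
      h.zero_left, h.zero_right, h.complete⟩
  simp [this.commonZerosPT_eq]

lemma not_eq_zero_of_irreducible {f : Polynomial F} (hf : Irreducible f)
    (hn : 1 < f.natDegree) (x : F) :
    f.eval x ≠ 0 := fun h =>
  hn.ne' (Polynomial.natDegree_eq_of_degree_eq_some
    (Polynomial.degree_eq_one_of_irreducible_of_root hf h))

lemma cubic_ne_zero {a b c : F}
    (h : Irreducible (Polynomial.X ^ 3 + Polynomial.C a * Polynomial.X ^ 2 +
      Polynomial.C b * Polynomial.X + Polynomial.C c : Polynomial F)) {v : Fin 3 → F}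
    (hv : v 2 ≠ 0) (hA : v 0 * v 2 = v 1 ^ 2) :
    v 0 * v 1 + a * v 1 ^ 2 + b * v 1 * v 2 + c * v 2 ^ 2 ≠ 0 := by
  intro h0
  refine not_eq_zero_of_irreducible h ?_ (v 1 / v 2) ?_
  · rw [show Polynomial.natDegree _ = 3 by compute_degree!]
    norm_num
  · simp
    field_simp
    linear_combination v 2 * h0 - v 1 * hA

lemma quartic_ne_zero {a b c d : F}
    (h : Irreducible (Polynomial.X ^ 4 + Polynomial.C a * Polynomial.X ^ 3 +
      Polynomial.C b * Polynomial.X ^ 2 + Polynomial.C c * Polynomial.X +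
      Polynomial.C d : Polynomial F)) {v : Fin 3 → F} (hv : v 2 ≠ 0)
    (hA : v 0 * v 2 = v 1 ^ 2) :
    v 0 ^ 2 + a * v 0 * v 1 + b * v 1 ^ 2 + c * v 1 * v 2 + d * v 2 ^ 2 ≠ 0 := by
  intro h0
  refine not_eq_zero_of_irreducible h ?_ (v 1 / v 2) ?_
  · rw [show Polynomial.natDegree _ = 4 by compute_degree!]
    norm_num
  · simp
    field_simp
    linear_combination v 2 ^ 2 * h0 - (v 0 * v 2 + v 1 ^ 2 + a * v 1 * v 2) * hA

end ZeroCounts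

/-- The representatives of the twenty orbits. -/
def orbitRep (l a₃ b₃ c₃ a₄ b₄ c₄ d₄ : F) : Fin 20 → (Fin 6 → F) × (Fin 6 → F) :=
  ![(0, 0),
    (0, ![0,0,0,0,0,1]),
    (0, ![0,0,0,0,1,0]),
    (0, ![0,0,0,1,0,-l]),
    (0, ![1,0,0,0,-1,0]),
    (![0,0,0,0,0,1], ![0,0,0,0,1,0]),
    (![0,0,0,0,1,0], ![0,0,1,0,0,0]),
    (![0,0,0,0,0,1], ![0,0,0,1,0,0]),
    (![0,0,0,0,1,0], ![0,0,0,1,0,l]),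
    (![0,0,0,0,0,1], ![0,0,1,1,0,0]),
    (![0,0,0,0,1,0], ![0,0,1,1,0,0]),
    (![0,0,0,0,0,1], ![1,0,0,-1,0,0]),
    (![0,0,0,0,0,1], ![1,0,0,-l,0,0]),
    (![0,0,0,1,0,-1], ![0,0,1,0,0,0]),
    (![0,0,0,1,0,-l], ![0,0,1,0,0,0]),
    (![0,0,1,0,-1,0], ![0,1,0,0,-1,0]),
    (![0,0,0,0,1,0], ![1,0,0,-1,0,-l]),
    (![0,0,0,0,1,0], ![1,0,0,-l,0,-l]),
    (![0,0,1,-1,0,0], ![0,1,0,a₃,b₃,c₃]),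
    (![0,0,1,-1,0,0], ![1,a₄,0,b₄,c₄,d₄])]

/-- The numbers of common zeros in the twenty orbits over a field with `n` elements. -/
def orbitZeros (n : ℕ) : Fin 20 → ℕ :=
  ![n ^ 2 + n + 1, n + 1, 2 * n + 1, 1, n + 1, n + 1, n + 2, 1, 1, 1, 2, 2, 0, 3, 1, 4, 2, 0, 1, 0]

lemma commonZerosPT_orbitRep {l : F} (hl : ¬ IsSquare l) {a₃ b₃ c₃ : F}
    (h3 : Irreducible (Polynomial.X ^ 3 + Polynomial.C a₃ * Polynomial.X ^ 2 +
      Polynomial.C b₃ * Polynomial.X + Polynomial.C c₃ : Polynomial F))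
    {a₄ b₄ c₄ d₄ : F}
    (h4 : Irreducible (Polynomial.X ^ 4 + Polynomial.C a₄ * Polynomial.X ^ 3 +
      Polynomial.C b₄ * Polynomial.X ^ 2 + Polynomial.C c₄ * Polynomial.X +
      Polynomial.C d₄ : Polynomial F)) (i : Fin 20) :
    commonZerosPT (orbitRep l a₃ b₃ c₃ a₄ b₄ c₄ d₄ i) = orbitZeros (Fintype.card F) i := by
  have h2 := two_ne_zero_of_not_isSquare hl
  have hn {x y : F} (h : x ^ 2 = l * y ^ 2) : x = 0 ∧ y = 0 := eq_zero_of_sq_eq_mul_sq hl h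
  fin_cases i
  · exact commonZerosPT_zero
  · exact commonZerosPT_line fun v => by simp [formEval]
  · exact commonZerosPT_two_lines
  · refine commonZerosPT_eq_one fun v => ?_
    simp [formEval]
    exact ⟨fun h => hn (by linear_combination h), by grind⟩
  · exact commonZerosPT_conic
  · exact commonZerosPT_line fun v => by simp +contextual [formEval]
  · exact commonZerosPT_line_and_point
  · exact commonZerosPT_eq_one fun v => by simp [formEval, and_comm]
  · exact commonZerosPT_eq_one fun v => by simp [formEval]; grind
  · exact commonZerosPT_eq_one fun v => by simp [formEval]; grind
  · exact commonZerosPT_mul_conic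
  · exact commonZerosPT_split h2 fun v => by simp [formEval]; grind
  · refine commonZerosPT_eq_zero fun v hA hB => ?_
    simp [formEval] at hA hB
    obtain ⟨h0, h1⟩ := hn (x := v 0) (y := v 1) (by linear_combination hB)
    ext j; fin_cases j <;> assumption
  · exact commonZerosPT_split_mul h2
  · refine commonZerosPT_eq_one fun v => ?_
    simp [formEval]
    exact ⟨fun h => hn (by linear_combination h.1), by grind⟩
  · exact commonZerosPT_rational
  · refine commonZerosPT_split h2 fun v => ?_
    simp [formEval]
    refine ⟨fun ⟨h, h'⟩ => ?_, by grind⟩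
    obtain h | h := h
    · have := hn (x := v 0) (y := v 2) (by rw [h] at h'; linear_combination h')
      simp [this, h]
    · exact ⟨h, by rw [h] at h'; linear_combination h'⟩
  · refine commonZerosPT_eq_zero fun v hA hB => ?_
    simp [formEval] at hA hB
    have : v 0 = 0 ∧ v 1 = 0 ∧ v 2 = 0 := by
      obtain h | h := hA
      · have := hn (x := v 0) (y := v 2) (by rw [h] at hB; linear_combination hB)
        simp [this, h]
      · have := hn (x := v 0) (y := v 1) (by rw [h] at hB; linear_combination hB)
        simp [this, h]
    ext j; fin_cases j <;> simp [this]
  · refine commonZerosPT_eq_one fun v => ?_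
    simp [formEval]
    refine ⟨fun ⟨hA, hB⟩ => ?_, fun ⟨h, h'⟩ => by simp [h, h']⟩
    have hv2 : v 2 = 0 := by_contra fun h =>
      cubic_ne_zero h3 h (by linear_combination hA) hB
    simpa [hv2] using hA
  · refine commonZerosPT_eq_zero fun v hA hB => ?_
    simp [formEval] at hA hB
    have hv2 : v 2 = 0 := by_contra fun h =>
      quartic_ne_zero h4 h (by linear_combination hA) hB
    have hv1 : v 1 = 0 := by simpa [hv2] using hA
    have hv0 : v 0 = 0 := by simpa [hv2, hv1] using hB
    ext j; fin_cases j <;> assumption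

section Invariants

namespace FormPair

/-- The two forms are linearly dependent. -/
def IsDependent (x : FormPair F) : Prop :=
  ∃ α β : F, (α ≠ 0 ∨ β ≠ 0) ∧ α • x.fst + β • x.snd = 0

/-- The two forms have a common vector in the kernels of their polarizations. -/
def HasCommonKernel (x : FormPair F) : Prop :=
  ∃ v : Fin 3 → F, v ≠ 0 ∧ ∀ y, formPolar x.fst v y = 0 ∧ formPolar x.snd v y = 0

/-- Some combination of the two forms is a nonzero multiple of the square of a linear form. -/
def HasSquareMember (x : FormPair F) : Prop :=
  ∃ (α β c : F) (m : Fin 3 → F), c ≠ 0 ∧ m ≠ 0 ∧ α • x.fst + β • x.snd = c • linProd m m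

/-- Some combination of the two forms is a product of two nonzero linear forms. -/
def HasSplitMember (x : FormPair F) : Prop :=
  ∃ (α β : F) (k m : Fin 3 → F), k ≠ 0 ∧ m ≠ 0 ∧ α • x.fst + β • x.snd = linProd k m

/-- Some nontrivial combination of the two forms is singular at a common zero. -/
def HasSingularZero (x : FormPair F) : Prop :=
  ∃ v : Fin 3 → F, v ≠ 0 ∧ formEval x.fst v = 0 ∧ formEval x.snd v = 0 ∧
    ∃ α β : F, (α ≠ 0 ∨ β ≠ 0) ∧ ∀ y, α * formPolar x.fst v y + β * formPolar x.snd v y = 0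

variable {x : FormPair F} {g : GL (Fin 2) F × GL (Fin 3) F}

lemma combination_smul (α β : F) : α • (g • x).fst + β • (g • x).snd =
    formSubst (g.2 : Matrix (Fin 3) (Fin 3) F)
      ((α * g.1 0 0 + β * g.1 1 0) • x.fst + (α * g.1 0 1 + β * g.1 1 1) • x.snd) := by
  simp only [smul_fst, smul_snd, formSubst_add, formSubst_smul]
  module

lemma det_ne_zero : g.1 0 0 * g.1 1 1 - g.1 0 1 * g.1 1 0 ≠ 0 := by
  rw [← Matrix.det_fin_two]
  exact (Matrix.isUnit_iff_isUnit_det _).mp g.1.isUnit |>.ne_zero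

lemma coeff_ne_zero {α β : F} (h : α ≠ 0 ∨ β ≠ 0) :
    α * g.1 0 0 + β * g.1 1 0 ≠ 0 ∨ α * g.1 0 1 + β * g.1 1 1 ≠ 0 := by
  by_contra! h'
  refine h.elim (fun h => h (mul_right_cancel₀ (det_ne_zero (g := g)) ?_))
    fun h => h (mul_right_cancel₀ (det_ne_zero (g := g)) ?_)
  · linear_combination g.1 1 1 * h'.1 - g.1 1 0 * h'.2
  · linear_combination g.1 0 0 * h'.2 - g.1 0 1 * h'.1

lemma eq_formSubst_inv {h : GL (Fin 3) F} {c d : Fin 6 → F}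
    (hcd : formSubst (h : Matrix (Fin 3) (Fin 3) F) c = d) :
    c = formSubst ((h⁻¹ : GL (Fin 3) F) : Matrix (Fin 3) (Fin 3) F) d := by
  rw [← hcd, ← formSubst_mul, ← Units.val_mul, inv_mul_cancel, Units.val_one, formSubst_one]

lemma mulVec_ne_zero (h : GL (Fin 3) F) {m : Fin 3 → F} (hm : m ≠ 0) :
    (h : Matrix (Fin 3) (Fin 3) F) *ᵥ m ≠ 0 := fun h0 => hm <| by
  rw [← Matrix.one_mulVec m, ← Units.val_one, ← inv_mul_cancel h, Units.val_mul,
    ← Matrix.mulVec_mulVec, h0, Matrix.mulVec_zero]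

lemma vecMul_ne_zero (h : GL (Fin 3) F) {m : Fin 3 → F} (hm : m ≠ 0) :
    m ᵥ* (h : Matrix (Fin 3) (Fin 3) F) ≠ 0 := fun h0 => hm <| by
  rw [← Matrix.vecMul_one m, ← Units.val_one, ← mul_inv_cancel h, Units.val_mul,
    ← Matrix.vecMul_vecMul, h0, Matrix.zero_vecMul]

lemma IsDependent.of_smul (h : (g • x).IsDependent) : x.IsDependent := by
  obtain ⟨α, β, h0, h⟩ := h
  refine ⟨_, _, coeff_ne_zero (g := g) h0, ?_⟩
  rw [combination_smul] at h
  rw [eq_formSubst_inv h]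
  simpa using formSubst_smul _ (0 : F) (0 : Fin 6 → F)

lemma HasSquareMember.of_smul (h : (g • x).HasSquareMember) : x.HasSquareMember := by
  obtain ⟨α, β, c, m, hc, hm, h⟩ := h
  rw [combination_smul] at h
  refine ⟨_, _, c, _, hc, mulVec_ne_zero g.2⁻¹ hm, (eq_formSubst_inv h).trans ?_⟩
  rw [formSubst_smul, formSubst_linProd]

lemma HasSplitMember.of_smul (h : (g • x).HasSplitMember) : x.HasSplitMember := by
  obtain ⟨α, β, k, m, hk, hm, h⟩ := h
  rw [combination_smul] at h
  exact ⟨_, _, _, _, mulVec_ne_zero g.2⁻¹ hk, mulVec_ne_zero g.2⁻¹ hm,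
    (eq_formSubst_inv h).trans (formSubst_linProd _ _ _)⟩

lemma formEval_eq_zero_of_smul {v : Fin 3 → F} (h1 : formEval (g • x).fst v = 0)
    (h2 : formEval (g • x).snd v = 0) :
    formEval x.fst (v ᵥ* (g.2 : Matrix (Fin 3) (Fin 3) F)) = 0 ∧
      formEval x.snd (v ᵥ* (g.2 : Matrix (Fin 3) (Fin 3) F)) = 0 := by
  simp only [smul_fst, smul_snd, formEval_add, formEval_smul, formEval_formSubst] at h1 h2
  exact ⟨mul_left_cancel₀ (det_ne_zero (g := g))
      (by linear_combination g.1 1 1 * h1 - g.1 0 1 * h2),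
    mul_left_cancel₀ (det_ne_zero (g := g))
      (by linear_combination g.1 0 0 * h2 - g.1 1 0 * h1)⟩

lemma vecMul_inv_vecMul (h : GL (Fin 3) F) (y : Fin 3 → F) :
    y ᵥ* ((h⁻¹ : GL (Fin 3) F) : Matrix (Fin 3) (Fin 3) F) ᵥ*
      (h : Matrix (Fin 3) (Fin 3) F) = y := by
  rw [Matrix.vecMul_vecMul, ← Units.val_mul, inv_mul_cancel, Units.val_one, Matrix.vecMul_one]

lemma HasCommonKernel.of_smul (h : (g • x).HasCommonKernel) : x.HasCommonKernel := by
  obtain ⟨v, hv, h⟩ := h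
  refine ⟨_, vecMul_ne_zero g.2 hv, fun y => ?_⟩
  have := h (y ᵥ* ((g.2⁻¹ : GL (Fin 3) F) : Matrix (Fin 3) (Fin 3) F))
  simp only [smul_fst, smul_snd, formPolar_add, formPolar_smul, formPolar_formSubst,
    vecMul_inv_vecMul] at this
  obtain ⟨h1, h2⟩ := this
  exact ⟨mul_left_cancel₀ (det_ne_zero (g := g))
      (by linear_combination g.1 1 1 * h1 - g.1 0 1 * h2),
    mul_left_cancel₀ (det_ne_zero (g := g))
      (by linear_combination g.1 0 0 * h2 - g.1 1 0 * h1)⟩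

lemma HasSingularZero.of_smul (h : (g • x).HasSingularZero) : x.HasSingularZero := by
  obtain ⟨v, hv, hA, hB, α, β, h0, h⟩ := h
  obtain ⟨hA, hB⟩ := formEval_eq_zero_of_smul hA hB
  refine ⟨_, vecMul_ne_zero g.2 hv, hA, hB, _, _, coeff_ne_zero (g := g) h0, fun y => ?_⟩
  have := h (y ᵥ* ((g.2⁻¹ : GL (Fin 3) F) : Matrix (Fin 3) (Fin 3) F))
  simp only [smul_fst, smul_snd, formPolar_add, formPolar_smul, formPolar_formSubst,
    vecMul_inv_vecMul] at this
  linear_combination this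

end FormPair

/-- An invariant property that holds for `x` and fails for `y` separates their orbits. -/
lemma FormPair.disjoint_orbit {p : FormPair F → Prop}
    (hp : ∀ (x : FormPair F) (g : GL (Fin 2) F × GL (Fin 3) F), p (g • x) → p x)
    {x y : FormPair F} (hx : p x) (hy : ¬ p y) :
    Disjoint (MulAction.orbit (GL (Fin 2) F × GL (Fin 3) F) x)
      (MulAction.orbit (GL (Fin 2) F × GL (Fin 3) F) y) := by
  refine (MulAction.orbit.eq_or_disjoint x y).resolve_left fun h => hy ?_
  obtain ⟨g, hg⟩ : x ∈ MulAction.orbit (GL (Fin 2) F × GL (Fin 3) F) y :=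
    h ▸ MulAction.mem_orbit_self x
  exact hp y g (by rwa [← hg] at hx)

end Invariants

section Separation

namespace FormPair

/-- The pair with the given components, as a `FormPair`. -/
def ofProd (x : (Fin 6 → F) × (Fin 6 → F)) : FormPair F := (FormPair.equivProd F).symm x

@[simp]
lemma ofProd_fst (x : (Fin 6 → F) × (Fin 6 → F)) : (ofProd x).fst = x.1 := rfl

@[simp]
lemma ofProd_snd (x : (Fin 6 → F) × (Fin 6 → F)) : (ofProd x).snd = x.2 := rfl

end FormPair

open FormPair

lemma orbitZeros_ne {n : ℕ} (hn : 3 ≤ n) {i j : Fin 20} (hij : i < 5 ↔ j < 5)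
    (h : orbitZeros 3 i ≠ orbitZeros 3 j) : orbitZeros n i ≠ orbitZeros n j := by
  have hn' : 3 * n ≤ n ^ 2 := by nlinarith
  fin_cases i <;> fin_cases j <;> simp [orbitZeros] at hij h ⊢ <;> omega

variable {l a₃ b₃ c₃ a₄ b₄ c₄ d₄ : F}

lemma independent_orbitRep {i : Fin 20} (hi : ¬ i < 5) (α β : F)
    (h : α • (orbitRep l a₃ b₃ c₃ a₄ b₄ c₄ d₄ i).1 +
      β • (orbitRep l a₃ b₃ c₃ a₄ b₄ c₄ d₄ i).2 = 0) : α = 0 ∧ β = 0 := by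
  fin_cases i <;> simp [Fin.lt_def] at hi <;>
    simp [orbitRep, funext_iff, Fin.forall_fin_succ] at h <;> grind

lemma isDependent_orbitRep (i : Fin 20) :
    (ofProd (orbitRep l a₃ b₃ c₃ a₄ b₄ c₄ d₄ i)).IsDependent ↔ i < 5 := by
  refine ⟨fun ⟨α, β, h0, h⟩ => by_contra fun hi => ?_, fun hi => ⟨1, 0, by simp, ?_⟩⟩
  · obtain ⟨rfl, rfl⟩ := independent_orbitRep hi α β h
    simp at h0
  · fin_cases i <;> simp [Fin.lt_def] at hi <;> simp [orbitRep]

lemma hasSquareMember_orbitRep {i : Fin 20} (hi : i ∈ ({1, 7, 9, 11, 12} : Finset (Fin 20))) :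
    (ofProd (orbitRep l a₃ b₃ c₃ a₄ b₄ c₄ d₄ i)).HasSquareMember := by
  have hw : (1 : F) • (![0,0,0,0,0,1] : Fin 6 → F) = (1 : F) • linProd ![0, 0, 1] ![0, 0, 1] := by
    ext j; fin_cases j <;> simp [linProd]
  fin_cases hi
  · exact ⟨0, 1, 1, ![0, 0, 1], one_ne_zero, by simp, by simpa [orbitRep] using hw⟩
  all_goals exact ⟨1, 0, 1, ![0, 0, 1], one_ne_zero, by simp, by simpa [orbitRep] using hw⟩

lemma not_hasSquareMember_orbitRep (hl : ¬ IsSquare l) {i : Fin 20}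
    (hi : i ∈ ({4, 8, 10, 14, 16, 17} : Finset (Fin 20))) :
    ¬ (ofProd (orbitRep l a₃ b₃ c₃ a₄ b₄ c₄ d₄ i)).HasSquareMember := by
  rintro ⟨α, β, c, m, hc, hm, h⟩
  have h2 := two_ne_zero_of_not_isSquare hl
  have hl' := ne_zero_of_not_isSquare hl
  have hn {x y : F} (h : x ^ 2 = l * y ^ 2) : x = 0 ∧ y = 0 := eq_zero_of_sq_eq_mul_sq hl h
  have hn' {x y : F} (h : c * x ^ 2 = l * (c * y ^ 2)) : x = 0 ∧ y = 0 :=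
    hn (mul_left_cancel₀ hc (by linear_combination h))
  have hm' : ¬ (m 0 = 0 ∧ m 1 = 0 ∧ m 2 = 0) := fun h => hm <| by
    ext j; fin_cases j <;> simp [h]
  have two_mul_eq (x : F) : x + x = 2 * x := (two_mul x).symm
  fin_cases hi <;>
    simp [orbitRep, funext_iff, Fin.forall_fin_succ, linProd, hc, mul_comm (m 1) (m 0),
      mul_comm (m 2) (m 0), mul_comm (m 2) (m 1), two_mul_eq, h2] at h
  · grind
  · have := hn' (x := m 2) (y := m 1) (by linear_combination l * h.2.2.2.1 - h.2.2.2.2.2)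
    grind
  all_goals grind

lemma hasCommonKernel_orbitRep {i : Fin 20} (hi : i ∈ ({7, 8} : Finset (Fin 20))) :
    (ofProd (orbitRep l a₃ b₃ c₃ a₄ b₄ c₄ d₄ i)).HasCommonKernel := by
  refine ⟨![1, 0, 0], by simp, fun y => ?_⟩
  fin_cases hi <;> simp [orbitRep, formPolar]

lemma not_hasCommonKernel_orbitRep (hl : ¬ IsSquare l) {i : Fin 20}
    (hi : i ∈ ({9, 14} : Finset (Fin 20))) :
    ¬ (ofProd (orbitRep l a₃ b₃ c₃ a₄ b₄ c₄ d₄ i)).HasCommonKernel := by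
  rintro ⟨v, hv, h⟩
  have h2 := two_ne_zero_of_not_isSquare hl
  have hl' := ne_zero_of_not_isSquare hl
  have h0 := h ![1, 0, 0]
  have h1 := h ![0, 1, 0]
  have h3 := h ![0, 0, 1]
  apply hv
  ext j
  fin_cases hi <;> fin_cases j <;> simp_all [orbitRep, formPolar]

lemma hasSingularZero_orbitRep {i : Fin 20}
    (hi : i ∈ ({5, 7, 8, 9, 10, 14} : Finset (Fin 20))) :
    (ofProd (orbitRep l a₃ b₃ c₃ a₄ b₄ c₄ d₄ i)).HasSingularZero := by
  refine ⟨![1, 0, 0], by simp, ?_, ?_, 1, 0, by simp, fun y => ?_⟩ <;>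
    fin_cases hi <;> simp [orbitRep, formPolar, formEval]

lemma not_hasSingularZero_orbitRep (hl : ¬ IsSquare l)
    (h3 : Irreducible (Polynomial.X ^ 3 + Polynomial.C a₃ * Polynomial.X ^ 2 +
      Polynomial.C b₃ * Polynomial.X + Polynomial.C c₃ : Polynomial F)) {i : Fin 20}
    (hi : i ∈ ({15, 16, 18} : Finset (Fin 20))) :
    ¬ (ofProd (orbitRep l a₃ b₃ c₃ a₄ b₄ c₄ d₄ i)).HasSingularZero := by
  rintro ⟨v, hv, hA, hB, α, β, h0, h⟩
  have h2 := two_ne_zero_of_not_isSquare hl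
  have hn {x y : F} (h : x ^ 2 = l * y ^ 2) : x = 0 ∧ y = 0 := eq_zero_of_sq_eq_mul_sq hl h
  have hv' : ¬ (v 0 = 0 ∧ v 1 = 0 ∧ v 2 = 0) := fun h => hv <| by
    ext j; fin_cases j <;> simp [h]
  have hx := h ![1, 0, 0]
  have hy := h ![0, 1, 0]
  have hz := h ![0, 0, 1]
  fin_cases hi <;> simp [orbitRep, formPolar, formEval] at hA hB hx hy hz
  · obtain ⟨i, c, rfl⟩ := (isBaseLocus_rational (F := F)).complete v hv
      (by simpa [formEval] using hA) (by simpa [formEval] using hB)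
    fin_cases i <;> simp at hx hy hz hv' <;> grind
  · obtain h1 | h1 := hA
    · have := hn (x := v 0) (y := v 2) (by rw [h1] at hB; linear_combination hB)
      grind
    · grind
  · have hv2 : v 2 = 0 := by_contra fun h =>
      cubic_ne_zero h3 h (by linear_combination hA) hB
    grind

lemma hasSplitMember_orbitRep {i : Fin 20} (hi : i ∈ ({12, 17} : Finset (Fin 20))) :
    (ofProd (orbitRep l a₃ b₃ c₃ a₄ b₄ c₄ d₄ i)).HasSplitMember := by
  fin_cases hi
  · refine ⟨1, 0, ![0, 0, 1], ![0, 0, 1], by simp, by simp, ?_⟩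
    ext j; fin_cases j <;> simp [orbitRep, linProd]
  · refine ⟨1, 0, ![0, 1, 0], ![0, 0, 1], by simp, by simp, ?_⟩
    ext j; fin_cases j <;> simp [orbitRep, linProd]

lemma not_hasSplitMember_orbitRep
    (h4 : Irreducible (Polynomial.X ^ 4 + Polynomial.C a₄ * Polynomial.X ^ 3 +
      Polynomial.C b₄ * Polynomial.X ^ 2 + Polynomial.C c₄ * Polynomial.X +
      Polynomial.C d₄ : Polynomial F)) :
    ¬ (ofProd (orbitRep l a₃ b₃ c₃ a₄ b₄ c₄ d₄ 19)).HasSplitMember := by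
  rintro ⟨α, β, k, m, hk, hm, h⟩
  set f := (Polynomial.X ^ 4 + Polynomial.C a₄ * Polynomial.X ^ 3 +
      Polynomial.C b₄ * Polynomial.X ^ 2 + Polynomial.C c₄ * Polynomial.X +
      Polynomial.C d₄ : Polynomial F) with hf
  let φ : (Fin 3 → F) → Polynomial F := fun v =>
    Polynomial.C (v 0) * Polynomial.X ^ 2 + Polynomial.C (v 1) * Polynomial.X + Polynomial.C (v 2)
  have hφ (v : Fin 3 → F) (hv : v ≠ 0) : ¬ f ∣ φ v := fun hd => by
    have h0 : φ v ≠ 0 := fun h0 => hv <| by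
      have hc (n : ℕ) : (φ v).coeff n = 0 := by simp [h0]
      have h2 := hc 2
      have h1 := hc 1
      have h0 := hc 0
      simp [φ, Polynomial.coeff_X, Polynomial.coeff_C] at h0 h1 h2
      refine _root_.funext fun j => ?_
      fin_cases j <;> assumption
    have h1 : f.natDegree = 4 := by rw [hf]; compute_degree!
    have h2 : (φ v).natDegree ≤ 2 := Polynomial.natDegree_quadratic_le
    have := Polynomial.natDegree_le_of_dvd hd h0
    omega
  have hmul : φ k * φ m = Polynomial.C β * f := by
    have e (j : Fin 6) := congrFun h j
    have e0 := e 0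
    have e1 := e 1
    have e2 := e 2
    have e3 := e 3
    have e4 := e 4
    have e5 := e 5
    simp [orbitRep, linProd] at e0 e1 e2 e3 e4 e5
    replace e0 := congrArg (Polynomial.C : F → _) e0
    replace e1 := congrArg (Polynomial.C : F → _) e1
    replace e2 := congrArg (Polynomial.C : F → _) e2
    replace e3 := congrArg (Polynomial.C : F → _) e3
    replace e4 := congrArg (Polynomial.C : F → _) e4
    replace e5 := congrArg (Polynomial.C : F → _) e5
    simp only [map_add, map_mul, map_neg] at e0 e1 e2 e3 e4 e5
    simp only [φ, hf]
    linear_combination -Polynomial.X ^ 4 * e0 - Polynomial.X ^ 3 * e1 - Polynomial.X ^ 2 * e2 -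
      Polynomial.X ^ 2 * e3 - Polynomial.X * e4 - e5
  exact (h4.prime.dvd_or_dvd (Dvd.intro_left _ hmul.symm)).elim (hφ k hk) (hφ m hm)

set_option synthInstance.maxSize 1000 in
lemma disjoint_orbit_orbitRep (hl : ¬ IsSquare l)
    (h3 : Irreducible (Polynomial.X ^ 3 + Polynomial.C a₃ * Polynomial.X ^ 2 +
      Polynomial.C b₃ * Polynomial.X + Polynomial.C c₃ : Polynomial F))
    (h4 : Irreducible (Polynomial.X ^ 4 + Polynomial.C a₄ * Polynomial.X ^ 3 +
      Polynomial.C b₄ * Polynomial.X ^ 2 + Polynomial.C c₄ * Polynomial.X +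
      Polynomial.C d₄ : Polynomial F)) :
    Pairwise fun i j => Disjoint
      (MulAction.orbit (GL (Fin 2) F × GL (Fin 3) F) (ofProd (orbitRep l a₃ b₃ c₃ a₄ b₄ c₄ d₄ i)))
      (MulAction.orbit (GL (Fin 2) F × GL (Fin 3) F)
        (ofProd (orbitRep l a₃ b₃ c₃ a₄ b₄ c₄ d₄ j))) := by
  intro i j hij
  have hq : 3 ≤ Fintype.card F := by
    have h1 := FiniteField.odd_card_of_char_ne_two (F := F) fun h =>
      hl (FiniteField.isSquare_of_char_two h l)
    have h2 := one_lt_card_field (F := F)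
    omega
  by_cases hd : i < 5 ↔ j < 5
  swap
  · have hD (i : Fin 20) := isDependent_orbitRep (l := l) (a₃ := a₃) (b₃ := b₃) (c₃ := c₃)
      (a₄ := a₄) (b₄ := b₄) (c₄ := c₄) (d₄ := d₄) i
    rw [← hD i, ← hD j] at hd
    by_cases hi : (ofProd (orbitRep l a₃ b₃ c₃ a₄ b₄ c₄ d₄ i)).IsDependent
    · have hj := fun hj => hd (iff_of_true hi hj)
      exact disjoint_orbit (fun _ _ => IsDependent.of_smul) hi hj
    · have hj := not_not.mp fun hj => hd (iff_of_false hi hj)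
      exact (disjoint_orbit (fun _ _ => IsDependent.of_smul) hj hi).symm
  by_cases hz : orbitZeros 3 i = orbitZeros 3 j
  swap
  · refine disjoint_orbit (p := fun x => commonZerosPT (x.fst, x.snd) =
      orbitZeros (Fintype.card F) i) (fun x g h => ?_) (commonZerosPT_orbitRep hl h3 h4 i) fun h =>
        orbitZeros_ne hq hd hz (h.symm.trans (commonZerosPT_orbitRep hl h3 h4 j))
    rwa [commonZerosPT_smul] at h
  have key : ∀ i j : Fin 20, i ≠ j → (i < 5 ↔ j < 5) → orbitZeros 3 i = orbitZeros 3 j →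
      (i ∈ ({1, 7, 9, 11, 12} : Finset (Fin 20)) ∧ j ∈ ({4, 8, 10, 14, 16, 17} : Finset (Fin 20)) ∨
        i ∈ ({7, 8} : Finset (Fin 20)) ∧ j ∈ ({9, 14} : Finset (Fin 20)) ∨
        i ∈ ({5, 7, 8, 9, 10, 14} : Finset (Fin 20)) ∧ j ∈ ({15, 16, 18} : Finset (Fin 20)) ∨
        i ∈ ({12, 17} : Finset (Fin 20)) ∧ j = 19) ∨
      (j ∈ ({1, 7, 9, 11, 12} : Finset (Fin 20)) ∧ i ∈ ({4, 8, 10, 14, 16, 17} : Finset (Fin 20)) ∨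
        j ∈ ({7, 8} : Finset (Fin 20)) ∧ i ∈ ({9, 14} : Finset (Fin 20)) ∨
        j ∈ ({5, 7, 8, 9, 10, 14} : Finset (Fin 20)) ∧ i ∈ ({15, 16, 18} : Finset (Fin 20)) ∨
        j ∈ ({12, 17} : Finset (Fin 20)) ∧ i = 19) := by
    decide +kernel
  have sep : ∀ i j : Fin 20,
      (i ∈ ({1, 7, 9, 11, 12} : Finset (Fin 20)) ∧ j ∈ ({4, 8, 10, 14, 16, 17} : Finset (Fin 20)) ∨
        i ∈ ({7, 8} : Finset (Fin 20)) ∧ j ∈ ({9, 14} : Finset (Fin 20)) ∨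
        i ∈ ({5, 7, 8, 9, 10, 14} : Finset (Fin 20)) ∧ j ∈ ({15, 16, 18} : Finset (Fin 20)) ∨
        i ∈ ({12, 17} : Finset (Fin 20)) ∧ j = 19) → Disjoint
      (MulAction.orbit (GL (Fin 2) F × GL (Fin 3) F) (ofProd (orbitRep l a₃ b₃ c₃ a₄ b₄ c₄ d₄ i)))
      (MulAction.orbit (GL (Fin 2) F × GL (Fin 3) F)
        (ofProd (orbitRep l a₃ b₃ c₃ a₄ b₄ c₄ d₄ j))) := by
    rintro i j (⟨hi, hj⟩ | ⟨hi, hj⟩ | ⟨hi, hj⟩ | ⟨hi, rfl⟩)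
    · exact disjoint_orbit (fun _ _ => HasSquareMember.of_smul) (hasSquareMember_orbitRep hi)
        (not_hasSquareMember_orbitRep hl hj)
    · exact disjoint_orbit (fun _ _ => HasCommonKernel.of_smul) (hasCommonKernel_orbitRep hi)
        (not_hasCommonKernel_orbitRep hl hj)
    · exact disjoint_orbit (fun _ _ => HasSingularZero.of_smul) (hasSingularZero_orbitRep hi)
        (not_hasSingularZero_orbitRep hl h3 hj)
    · exact disjoint_orbit (fun _ _ => HasSplitMember.of_smul) (hasSplitMember_orbitRep hi)
        (not_hasSplitMember_orbitRep h4)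
  exact (key i j hij hd hz).elim (sep i j) fun h => (sep j i h).symm

end Separation

section Count

open FormPair

/-- The sizes of the twenty orbits over a field with `q` elements. -/
def orbitSize (q : ℚ) : Fin 20 → ℚ :=
  let s : ℕ → ℕ → ℕ → ℚ := fun a b c => (q - 1) ^ a * q ^ b * (q + 1) ^ c * (q ^ 2 + q + 1)
  ![1, s 1 0 1, s 1 1 2 / 2, s 2 1 1 / 2, s 2 2 1, s 2 1 2, s 2 3 1, s 2 2 2 / 2,
    s 3 2 1 / 2, s 3 2 2, s 3 3 2, s 2 4 2 / 2, s 3 4 1 / 2, s 3 4 2 / 2, s 3 4 2 / 2,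
    s 4 4 2 / 24, s 4 4 2 / 4, s 4 4 2 / 8, s 4 4 2 / 3, s 4 4 2 / 4]

lemma sum_orbitSize (q : ℚ) : ∑ i, orbitSize q i = q ^ 12 := by
  simp [orbitSize, Fin.sum_univ_succ]
  ring

lemma le_card_orbit {x : FormPair F} {N : ℕ} {S : ℚ}
    (h : Nat.card (MulAction.stabilizer (GL (Fin 2) F × GL (Fin 3) F) x) ≤ N)
    (hS : S * N = ((Fintype.card F : ℚ) - 1) ^ 5 * (Fintype.card F : ℚ) ^ 4 *
      ((Fintype.card F : ℚ) + 1) ^ 2 * ((Fintype.card F : ℚ) ^ 2 + Fintype.card F + 1)) :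
    S ≤ Nat.card (MulAction.orbit (GL (Fin 2) F × GL (Fin 3) F) x) := by
  have hN : (0 : ℚ) < N := by exact_mod_cast Nat.card_pos.trans_le h
  exact le_of_mul_le_mul_right (hS ▸ le_card_orbit_mul h) hN

variable {l a₃ b₃ c₃ a₄ b₄ c₄ d₄ : F}

lemma orbitSize_le_card_orbit (hl : ¬ IsSquare l)
    (h3 : Irreducible (Polynomial.X ^ 3 + Polynomial.C a₃ * Polynomial.X ^ 2 +
      Polynomial.C b₃ * Polynomial.X + Polynomial.C c₃ : Polynomial F))
    (h4 : Irreducible (Polynomial.X ^ 4 + Polynomial.C a₄ * Polynomial.X ^ 3 +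
      Polynomial.C b₄ * Polynomial.X ^ 2 + Polynomial.C c₄ * Polynomial.X +
      Polynomial.C d₄ : Polynomial F)) (i : Fin 20) :
    orbitSize (Fintype.card F) i ≤ Nat.card
      (MulAction.orbit (GL (Fin 2) F × GL (Fin 3) F)
        (ofProd (orbitRep l a₃ b₃ c₃ a₄ b₄ c₄ d₄ i))) := by
  have h2 := two_ne_zero_of_not_isSquare hl
  have hq : 1 < Fintype.card F := Fintype.one_lt_card
  have e1 : ((Fintype.card F - 1 : ℕ) : ℚ) = Fintype.card F - 1 := by
    rw [Nat.cast_sub hq.le, Nat.cast_one]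
  have e2 : ((Fintype.card F ^ 2 - 1 : ℕ) : ℚ) = (Fintype.card F : ℚ) ^ 2 - 1 := by
    rw [Nat.cast_sub (Nat.one_le_pow _ _ hq.le), Nat.cast_pow, Nat.cast_one]
  have e3 : ((Fintype.card F ^ 2 - Fintype.card F : ℕ) : ℚ) =
      (Fintype.card F : ℚ) ^ 2 - Fintype.card F := by
    rw [Nat.cast_sub (Nat.le_self_pow two_ne_zero _), Nat.cast_pow]
  have line {B : Fin 6 → F} {N : ℕ} {S : ℚ} (hB : B ≠ 0) (h : (lineStabilizer B).card ≤ N)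
      (hS : S * ((Fintype.card F - 1) * Fintype.card F * N) = ((Fintype.card F : ℚ) - 1) ^ 5 *
        (Fintype.card F : ℚ) ^ 4 * ((Fintype.card F : ℚ) + 1) ^ 2 *
        ((Fintype.card F : ℚ) ^ 2 + Fintype.card F + 1)) :
      S ≤ Nat.card (MulAction.orbit (GL (Fin 2) F × GL (Fin 3) F) (ofProd (0, B))) :=
    le_card_orbit ((card_stabilizer_le_line hB).trans (Nat.mul_le_mul_left _ h))
      (by rw [← hS]; push_cast [e1]; ring)
  have pencil {i : Fin 20} (hi : ¬ i < 5) {N : ℕ} {S : ℚ}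
      (h : (pencilStabilizer (orbitRep l a₃ b₃ c₃ a₄ b₄ c₄ d₄ i).1
        (orbitRep l a₃ b₃ c₃ a₄ b₄ c₄ d₄ i).2).card ≤ N)
      (hS : S * N = ((Fintype.card F : ℚ) - 1) ^ 5 * (Fintype.card F : ℚ) ^ 4 *
        ((Fintype.card F : ℚ) + 1) ^ 2 * ((Fintype.card F : ℚ) ^ 2 + Fintype.card F + 1)) :
      S ≤ Nat.card (MulAction.orbit (GL (Fin 2) F × GL (Fin 3) F)
        (ofProd (orbitRep l a₃ b₃ c₃ a₄ b₄ c₄ d₄ i))) :=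
    le_card_orbit ((card_stabilizer_le_pencil (independent_orbitRep hi)).trans h) hS
  fin_cases i
  · exact Nat.one_le_cast.mpr <| Nat.card_pos_iff.mpr
      ⟨⟨_, MulAction.mem_orbit_self _⟩, inferInstance⟩
  on_goal 1 => refine line (fun h => by simpa using congrFun h 5) card_lineStabilizer_sq ?_
  on_goal 2 => refine line (fun h => by simpa using congrFun h 4) card_lineStabilizer_mul ?_
  on_goal 3 => refine line (fun h => by simpa using congrFun h 3) (card_lineStabilizer_norm l hl) ?_
  on_goal 4 => refine line (fun h => by simpa using congrFun h 0) card_lineStabilizer_conic ?_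
  on_goal 5 => refine pencil (i := 5) (by decide) card_pencilStabilizer_sq_mul ?_
  on_goal 6 => refine pencil (i := 6) (by decide) card_pencilStabilizer_mul_mul ?_
  on_goal 7 => refine pencil (i := 7) (by decide) (card_pencilStabilizer_sq_sq h2) ?_
  on_goal 8 => refine pencil (i := 8) (by decide) (card_pencilStabilizer_mul_norm l hl) ?_
  on_goal 9 => refine pencil (i := 9) (by decide) (card_pencilStabilizer_sq_conic h2) ?_
  on_goal 10 => refine pencil (i := 10) (by decide) card_pencilStabilizer_mul_conic ?_
  on_goal 11 => refine pencil (i := 11) (by decide) (card_pencilStabilizer_sq_split h2) ?_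
  on_goal 12 => refine pencil (i := 12) (by decide) (card_pencilStabilizer_sq_norm h2 l hl) ?_
  on_goal 13 => refine pencil (i := 13) (by decide) (card_pencilStabilizer_split_mul h2) ?_
  on_goal 14 => refine pencil (i := 14) (by decide) (card_pencilStabilizer_norm_mul h2 l hl) ?_
  on_goal 15 => refine pencil (i := 15) (by decide) card_pencilStabilizer_rational ?_
  on_goal 16 => refine pencil (i := 16) (by decide) (card_pencilStabilizer_quadratic h2 l hl) ?_
  on_goal 17 => refine pencil (i := 17) (by decide) (card_pencilStabilizer_two_quadratic h2 l hl) ?_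
  on_goal 18 => refine pencil (i := 18) (by decide) (card_pencilStabilizer_cubic h3) ?_
  on_goal 19 => refine pencil (i := 19) (by decide) (card_pencilStabilizer_quartic h4) ?_
  all_goals simp [orbitSize, e1, e2, e3]; ring

/-- A family of pairwise disjoint sets with large enough sizes covers a finite type. -/
lemma card_eq_and_exists_mem_of_le {ι α : Type*} [Fintype ι] [Finite α] {S : ι → Set α}
    {c : ι → ℚ} (hS : Pairwise fun i j => Disjoint (S i) (S j))
    (hc : ∀ i, c i ≤ Nat.card (S i)) (hsum : ∑ i, c i = Nat.card α) :
    (∀ i, (Nat.card (S i) : ℚ) = c i) ∧ ∀ a, ∃ i, a ∈ S i := by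
  have hU : Nat.card (⋃ i, S i) = ∑ i, Nat.card (S i) := by
    rw [Nat.card_congr (Set.unionEqSigmaOfDisjoint hS), Nat.card_sigma]
  have hle : Nat.card (⋃ i, S i) ≤ Nat.card α := Finite.card_subtype_le _
  have hge : (Nat.card α : ℚ) ≤ Nat.card (⋃ i, S i) := by
    rw [← hsum, hU, Nat.cast_sum]
    exact Finset.sum_le_sum fun i _ => hc i
  have heq : Nat.card (⋃ i, S i) = Nat.card α := le_antisymm hle (by exact_mod_cast hge)
  refine ⟨fun i => ?_, fun a => ?_⟩
  · refine ((Finset.sum_eq_sum_iff_of_le fun i _ => hc i).mp ?_ i (Finset.mem_univ i)).symm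
    rw [hsum, ← heq, hU, Nat.cast_sum]
  · have : (⋃ i, S i) = Set.univ := by
      rw [Nat.card_coe_set_eq, ← Set.ncard_univ] at heq
      exact Set.eq_of_subset_of_ncard_le (Set.subset_univ _) heq.ge
    simpa using this.ge (Set.mem_univ a)

end Count

/-- orbits of `GL₂(F_q) × GL₃(F_q)` on pairs of ternary quadratic forms. -/
theorem stmt18 (p : ℕ) [Fact p.Prime] [CharP F p] (hp : p ≠ 2) (l : F) (hl : ¬ IsSquare l)
    (a₃ b₃ c₃ : F)
    (h3 : Irreducible (Polynomial.X ^ 3 + Polynomial.C a₃ * Polynomial.X ^ 2 +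
      Polynomial.C b₃ * Polynomial.X + Polynomial.C c₃ : Polynomial F))
    (a₄ b₄ c₄ d₄ : F)
    (h4 : Irreducible (Polynomial.X ^ 4 + Polynomial.C a₄ * Polynomial.X ^ 3 +
      Polynomial.C b₄ * Polynomial.X ^ 2 + Polynomial.C c₄ * Polynomial.X +
      Polynomial.C d₄ : Polynomial F)) :
    let r : Fin 20 → (Fin 6 → F) × (Fin 6 → F) :=
      ![(0, 0),
        (0, ![0,0,0,0,0,1]),
        (0, ![0,0,0,0,1,0]),
        (0, ![0,0,0,1,0,-l]),
        (0, ![1,0,0,0,-1,0]),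
        (![0,0,0,0,0,1], ![0,0,0,0,1,0]),
        (![0,0,0,0,1,0], ![0,0,1,0,0,0]),
        (![0,0,0,0,0,1], ![0,0,0,1,0,0]),
        (![0,0,0,0,1,0], ![0,0,0,1,0,l]),
        (![0,0,0,0,0,1], ![0,0,1,1,0,0]),
        (![0,0,0,0,1,0], ![0,0,1,1,0,0]),
        (![0,0,0,0,0,1], ![1,0,0,-1,0,0]),
        (![0,0,0,0,0,1], ![1,0,0,-l,0,0]),
        (![0,0,0,1,0,-1], ![0,0,1,0,0,0]),
        (![0,0,0,1,0,-l], ![0,0,1,0,0,0]),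
        (![0,0,1,0,-1,0], ![0,1,0,0,-1,0]),
        (![0,0,0,0,1,0], ![1,0,0,-1,0,-l]),
        (![0,0,0,0,1,0], ![1,0,0,-l,0,-l]),
        (![0,0,1,-1,0,0], ![0,1,0,a₃,b₃,c₃]),
        (![0,0,1,-1,0,0], ![1,a₄,0,b₄,c₄,d₄])]
    let q : ℚ := (Fintype.card F : ℚ)
    let s : ℕ → ℕ → ℕ → ℚ := fun a b c => (q-1)^a * q^b * (q+1)^c * (q^2 + q + 1)
    let n : ℕ := Fintype.card F
    (∀ i j : Fin 20, i ≠ j →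
      ¬ ∃ x : (Fin 6 → F) × (Fin 6 → F), InOrbitPT (r i) x ∧ InOrbitPT (r j) x) ∧
    (∀ x : (Fin 6 → F) × (Fin 6 → F), ∃ i : Fin 20, InOrbitPT (r i) x) ∧
    (∀ i : Fin 20, (Nat.card {x : (Fin 6 → F) × (Fin 6 → F) // InOrbitPT (r i) x} : ℚ) =
      ![1, s 1 0 1, s 1 1 2 / 2, s 2 1 1 / 2, s 2 2 1, s 2 1 2, s 2 3 1, s 2 2 2 / 2,
        s 3 2 1 / 2, s 3 2 2, s 3 3 2, s 2 4 2 / 2, s 3 4 1 / 2, s 3 4 2 / 2, s 3 4 2 / 2,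
        s 4 4 2 / 24, s 4 4 2 / 4, s 4 4 2 / 8, s 4 4 2 / 3, s 4 4 2 / 4] i) ∧
    (∀ (i : Fin 20) (x : (Fin 6 → F) × (Fin 6 → F)), InOrbitPT (r i) x →
      commonZerosPT x =
        ![n^2 + n + 1, n + 1, 2*n + 1, 1, n + 1, n + 1, n + 2, 1, 1, 1,
          2, 2, 0, 3, 1, 4, 2, 0, 1, 0] i) := by
  intro r q s n
  have hcard : Nat.card (FormPair F) = Fintype.card F ^ 12 := by
    rw [Nat.card_congr (FormPair.equivProd F)]
    simp [Nat.card_eq_fintype_card, ← pow_add]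
  have hdisj := disjoint_orbit_orbitRep hl h3 h4
  obtain ⟨hsize, hcover⟩ := card_eq_and_exists_mem_of_le hdisj
    (orbitSize_le_card_orbit hl h3 h4) (by rw [sum_orbitSize, hcard, Nat.cast_pow])
  refine ⟨fun i j hij => ?_, fun x => ?_, fun i => ?_, fun i x hx => ?_⟩
  · rintro ⟨x, hi, hj⟩
    exact Set.disjoint_left.mp (hdisj hij) ((inOrbitPT_iff _ _).mp hi) ((inOrbitPT_iff _ _).mp hj)
  · obtain ⟨i, hi⟩ := hcover ⟨x.1, x.2⟩
    exact ⟨i, (inOrbitPT_iff _ _).mpr hi⟩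
  · refine Eq.trans (congrArg _ ?_) (hsize i)
    exact Nat.card_congr ((FormPair.equivProd F).symm.subtypeEquiv fun x => inOrbitPT_iff _ _)
  · obtain ⟨g, hg⟩ := (inOrbitPT_iff _ _).mp hx
    have := commonZerosPT_smul g (FormPair.ofProd (r i))
    have hg' : g • FormPair.ofProd (r i) = ⟨x.1, x.2⟩ := hg
    rw [hg'] at this
    exact this.trans (commonZerosPT_orbitRep hl h3 h4 i)

end
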